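/- arXiv:1411.1703 — 6 statements merged into one kernel-verified Lean document; each statement's English description precedes it below -/
import Mathlib

section
/- Let n ≥ 1 be an integer and ℓ ≥ 5 a prime. Let H be a closed subgroup of Sp_{2n}(ℤ_ℓ) whose image under entrywise reduction modulo ℓ contains Sp_{2n}(F_ℓ). Then H = Sp_{2n}(ℤ_ℓ). -/
open Matrix

theorem exists_one_add_pow_eq {R : Type*} [CommRing R] (x : R) (k : ℕ) :
    ∃ r : R, (1 + x) ^ k =
      1 + k * x + (k.choose 2 : ℕ) * x ^ 2 + (k.choose 3 : ℕ) * x ^ 3 + x ^ 4 * r := by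
  induction k with
  | zero => exact ⟨0, by simp⟩
  | succ k ih =>
    obtain ⟨r, hr⟩ := ih
    refine ⟨r * (1 + x) + (k.choose 3 : ℕ), ?_⟩
    rw [pow_succ, hr, Nat.choose_succ_succ' k 1, Nat.choose_succ_succ' k 2, Nat.choose_one_right]
    push_cast
    ring

theorem exists_one_add_pow_eq_of_sq {R A : Type*} [CommRing R] [Ring A] [Algebra R A]
    {p : ℕ} (hp : p.Prime) (h5 : 5 ≤ p) (m : ℕ) {Z W : A}
    (hZ : Z ^ 2 = (p : R) ^ (m + 1) • W) :
    ∃ V : A, (1 + Z) ^ p = 1 + (p : R) • Z + (p : R) ^ (m + 2) • V := by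
  obtain ⟨r, hr⟩ := exists_one_add_pow_eq (Polynomial.X : Polynomial ℤ) p
  obtain ⟨a, ha⟩ := hp.dvd_choose_self (k := 2) (by norm_num) (by lia)
  obtain ⟨b, hb⟩ := hp.dvd_choose_self (k := 3) (by norm_num) (by lia)
  have key := congrArg (Polynomial.aeval Z) hr
  have h3 : Z ^ 3 = (p : R) ^ (m + 1) • (W * Z) := by
    rw [pow_succ, hZ, smul_mul_assoc]
  have h4 : Z ^ 4 = (p : R) ^ (m + 2) • (p : R) ^ m • (W * W) := by
    rw [show 4 = 2 + 2 from rfl, pow_add, hZ, smul_mul_smul_comm, smul_smul]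
    congr 1
    ring
  simp only [map_add, map_mul, map_pow, map_one, map_natCast, Polynomial.aeval_X, h3, h4, hZ,
    ha, hb] at key
  refine ⟨(a : R) • W + (b : R) • (W * Z) + (p : R) ^ m • (W * W) * Polynomial.aeval Z r, ?_⟩
  have hcast (k : ℕ) (x : A) : (k : A) * x = (k : R) • x := by
    rw [Nat.cast_smul_eq_nsmul, nsmul_eq_mul]
  rw [key]
  simp only [hcast, smul_mul_assoc]
  push_cast
  module

section

variable {l R : Type*} [DecidableEq l] [Fintype l] [CommRing R]

/-- The matrix `X` is the leading term of some element `1 + p ^ m • X + ⋯` of `H`. -/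
def IsLeadingTerm (H : Subgroup (symplecticGroup l R)) (p : R) (m : ℕ)
    (X : Matrix (l ⊕ l) (l ⊕ l) R) : Prop :=
  ∃ h ∈ H, ∃ Y, (h : Matrix (l ⊕ l) (l ⊕ l) R) = 1 + p ^ m • X + p ^ (m + 1) • Y

variable {H : Subgroup (symplecticGroup l R)} {X X' : Matrix (l ⊕ l) (l ⊕ l) R}

theorem IsLeadingTerm.add {p : R} {m : ℕ} (hX : IsLeadingTerm H p (m + 1) X)
    (hX' : IsLeadingTerm H p (m + 1) X') : IsLeadingTerm H p (m + 1) (X + X') := by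
  obtain ⟨h, hh, Y, hY⟩ := hX
  obtain ⟨h', hh', Y', hY'⟩ := hX'
  refine ⟨h * h', mul_mem hh hh', Y + Y' + p ^ m • ((X + p • Y) * (X' + p • Y')), ?_⟩
  rw [Submonoid.coe_mul, hY, hY']
  simp only [mul_add, add_mul, smul_mul_assoc, mul_smul_comm, mul_one, one_mul]
  module

theorem IsLeadingTerm.succ {p : ℕ} (hp : p.Prime) (h5 : 5 ≤ p) {m : ℕ} (hX2 : X * X = 0)
    (hX : IsLeadingTerm H (p : R) m X) : IsLeadingTerm H (p : R) (m + 1) X := by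
  obtain ⟨h, hh, Y, hY⟩ := hX
  have hZ : ((p : R) ^ m • X + (p : R) ^ (m + 1) • Y) ^ 2 = (p : R) ^ (m + 1) •
      (p : R) ^ m • (X * Y + Y * X + (p : R) • (Y * Y)) := by
    simp only [sq, mul_add, add_mul, smul_mul_assoc, mul_smul_comm, hX2]
    module
  obtain ⟨V, hV⟩ := exists_one_add_pow_eq_of_sq hp h5 m hZ
  refine ⟨h ^ p, pow_mem hh p, Y + V, ?_⟩
  rw [SubmonoidClass.coe_pow, hY, add_assoc, hV]
  module

theorem one_add_mem_symplecticGroup (hX : X * J l R + J l R * Xᵀ = 0) (hX2 : X * X = 0) :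
    1 + X ∈ symplecticGroup l R := by
  have h : J l R * Xᵀ = -(X * J l R) := (neg_eq_of_add_eq_zero_right hX).symm
  rw [SymplecticGroup.mem_iff, transpose_add, transpose_one]
  have : X * J l R * Xᵀ = 0 := by
    rw [mul_assoc, h, mul_neg, ← mul_assoc, hX2, zero_mul, neg_zero]
  simp only [add_mul, mul_add, mul_one, one_mul, this, h]
  abel

theorem isLeadingTerm_of_sq_zero {p : ℕ} (hp : p.Prime) (h5 : 5 ≤ p)
    (hH : ∀ g : symplecticGroup l R, ∃ h ∈ H, ∃ Y,
      (h : Matrix (l ⊕ l) (l ⊕ l) R) = g + (p : R) • Y)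
    (hX : X * J l R + J l R * Xᵀ = 0) (hX2 : X * X = 0) (m : ℕ) :
    IsLeadingTerm H (p : R) m X := by
  induction m with
  | zero =>
    obtain ⟨h, hh, Y, hY⟩ := hH ⟨1 + X, one_add_mem_symplecticGroup hX hX2⟩
    exact ⟨h, hh, Y, by simpa using hY⟩
  | succ m ih => exact ih.succ hp h5 hX2

theorem isLeadingTerm_fromBlocks_of_sq_zero {p : ℕ} (hp : p.Prime) (h5 : 5 ≤ p)
    (hH : ∀ g : symplecticGroup l R, ∃ h ∈ H, ∃ Y,
      (h : Matrix (l ⊕ l) (l ⊕ l) R) = g + (p : R) • Y)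
    {A B C : Matrix l l R} (hB : Bᵀ = B) (hC : Cᵀ = C) (h₁ : A * A + B * C = 0)
    (h₂ : A * B = B * Aᵀ) (h₃ : C * A = Aᵀ * C) (h₄ : C * B + Aᵀ * Aᵀ = 0) (m : ℕ) :
    IsLeadingTerm H (p : R) m (fromBlocks A B C (-Aᵀ)) := by
  apply isLeadingTerm_of_sq_zero hp h5 hH
  · simp [J, fromBlocks_transpose, fromBlocks_multiply, fromBlocks_add, hB, hC]
  · simp [fromBlocks_multiply, h₁, h₂, h₃, h₄]

theorem isLeadingTerm_fromBlocks {p : ℕ} (hp : p.Prime) (h5 : 5 ≤ p)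
    (hH : ∀ g : symplecticGroup l R, ∃ h ∈ H, ∃ Y,
      (h : Matrix (l ⊕ l) (l ⊕ l) R) = g + (p : R) • Y)
    (A : Matrix l l R) {B C : Matrix l l R} (hB : Bᵀ = B) (hC : Cᵀ = C) (m : ℕ) :
    IsLeadingTerm H (p : R) (m + 1) (fromBlocks A B C (-Aᵀ)) := by
  have hupper {B : Matrix l l R} (hB : Bᵀ = B) :
      IsLeadingTerm H (p : R) (m + 1) (fromBlocks 0 B 0 0) := by
    simpa using isLeadingTerm_fromBlocks_of_sq_zero hp h5 hH (A := 0) (C := 0) hB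
      (by simp) (by simp) (by simp) (by simp) (by simp) (m + 1)
  have hlower {C : Matrix l l R} (hC : Cᵀ = C) :
      IsLeadingTerm H (p : R) (m + 1) (fromBlocks 0 0 C 0) := by
    simpa using isLeadingTerm_fromBlocks_of_sq_zero hp h5 hH (A := 0) (B := 0)
      (by simp) hC (by simp) (by simp) (by simp) (by simp) (m + 1)
  have hdiag : IsLeadingTerm H (p : R) (m + 1) (fromBlocks A 0 0 (-Aᵀ)) := by
    induction A using Matrix.induction_on' with
    | h_zero => simpa using hupper (B := 0) (by simp)
    | h_add A A' hA hA' =>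
      simpa [fromBlocks_add, add_comm] using hA.add hA'
    | h_std_basis i j a =>
      by_cases hij : i = j
      · subst hij
        have ht : (Matrix.single i i a)ᵀ = Matrix.single i i a := transpose_single ..
        have h := isLeadingTerm_fromBlocks_of_sq_zero hp h5 hH (A := Matrix.single i i a)
          (B := -Matrix.single i i a) (C := Matrix.single i i a)
          (by rw [transpose_neg, ht]) ht (by simp) (by simp) (by simp) (by simp) (m + 1)
        simpa [fromBlocks_add] using
          (h.add (hupper ht)).add (hlower (C := -Matrix.single i i a) (by rw [transpose_neg, ht]))
      · exact isLeadingTerm_fromBlocks_of_sq_zero hp h5 hH (by simp) (by simp)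
          (by simp [Matrix.single_mul_single_of_ne, Ne.symm hij]) (by simp) (by simp)
          (by simp [Matrix.single_mul_single_of_ne, hij]) (m + 1)
  simpa [fromBlocks_add] using (hdiag.add (hupper hB)).add (hlower hC)

theorem isLeadingTerm_of_mem_lieAlgebra {p : ℕ} (hp : p.Prime) (h5 : 5 ≤ p)
    (hH : ∀ g : symplecticGroup l R, ∃ h ∈ H, ∃ Y,
      (h : Matrix (l ⊕ l) (l ⊕ l) R) = g + (p : R) • Y)
    (hX : X * J l R + J l R * Xᵀ = 0) (m : ℕ) : IsLeadingTerm H (p : R) (m + 1) X := by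
  obtain ⟨A, B, C, D, rfl⟩ : ∃ A B C D, X = fromBlocks A B C D :=
    ⟨_, _, _, _, (fromBlocks_toBlocks X).symm⟩
  rw [← fromBlocks_zero] at hX
  simp only [J, fromBlocks_transpose, fromBlocks_multiply, fromBlocks_add, fromBlocks_inj,
    mul_zero, mul_one, zero_mul, one_mul, mul_neg, neg_mul, zero_add, add_zero] at hX
  obtain ⟨h₁, -, h₃, h₄⟩ := hX
  obtain rfl : D = -Aᵀ := eq_neg_of_add_eq_zero_left h₃
  exact isLeadingTerm_fromBlocks hp h5 hH A (add_neg_eq_zero.mp h₁).symm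
    (neg_add_eq_zero.mp h₄).symm m

theorem exists_lieAlgebra_congr [IsDomain R] {p c : R} (hp : p ≠ 0) (hc : 2 * c = 1) {m : ℕ}
    {Y : Matrix (l ⊕ l) (l ⊕ l) R} (hY : 1 + p ^ (m + 1) • Y ∈ symplecticGroup l R) :
    ∃ X V, X * J l R + J l R * Xᵀ = 0 ∧ Y = X + p • V := by
  have hJ := J_squared l R
  rw [SymplecticGroup.mem_iff] at hY
  set K := Y * J l R * Yᵀ with hK
  have hKt : Kᵀ = -K := by
    simp [hK, transpose_mul, mul_assoc]
  have hrel : p ^ (m + 1) • (Y * J l R + J l R * Yᵀ + p ^ (m + 1) • K) = 0 := by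
    rw [← sub_eq_zero.2 hY]
    simp only [hK, transpose_add, transpose_one, transpose_smul, mul_add, add_mul, smul_mul_assoc,
      mul_smul_comm, mul_one, one_mul]
    module
  have hrel' : Y * J l R + J l R * Yᵀ + p ^ (m + 1) • K = 0 :=
    (smul_eq_zero.1 hrel).resolve_left (pow_ne_zero _ hp)
  refine ⟨Y - (c * p ^ (m + 1)) • (K * J l R), (c * p ^ m) • (K * J l R), ?_, by module⟩
  have h₁ : K * J l R * J l R = -K := by rw [mul_assoc, hJ, mul_neg, mul_one]
  have h₂ : J l R * (K * J l R)ᵀ = -K := by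
    rw [transpose_mul, J_transpose, hKt, ← mul_assoc, mul_neg, mul_neg, hJ]
    simp
  have h₃ : p ^ (m + 1) • K = (c * p ^ (m + 1) + c * p ^ (m + 1)) • K := by
    congr 1
    linear_combination -p ^ (m + 1) * hc
  rw [sub_mul, transpose_sub, transpose_smul, mul_sub, smul_mul_assoc, mul_smul_comm, h₁, h₂,
    ← hrel', h₃]
  module

theorem exists_mem_congr_pow [IsDomain R] [CharZero R] {p : ℕ} (hp : p.Prime) (h5 : 5 ≤ p) {c : R} (hc : 2 * c = 1)
    (hH : ∀ g : symplecticGroup l R, ∃ h ∈ H, ∃ Y,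
      (h : Matrix (l ⊕ l) (l ⊕ l) R) = g + (p : R) • Y)
    (g : symplecticGroup l R) (m : ℕ) :
    ∃ h ∈ H, ∃ Y, (h : Matrix (l ⊕ l) (l ⊕ l) R) = g + (p : R) ^ (m + 1) • Y := by
  induction m with
  | zero => simpa using hH g
  | succ m ih =>
    obtain ⟨h, hh, Y, hY⟩ := ih
    have hmul : ((g⁻¹ * h : symplecticGroup l R) : Matrix (l ⊕ l) (l ⊕ l) R) =
        1 + (p : R) ^ (m + 1) • ((g⁻¹ : symplecticGroup l R) * Y) := by
      rw [Submonoid.coe_mul, hY, mul_add, mul_smul_comm, ← Submonoid.coe_mul, inv_mul_cancel,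
        Submonoid.coe_one]
    obtain ⟨X, V, hX, hV⟩ := exists_lieAlgebra_congr
      (Nat.cast_ne_zero.2 hp.ne_zero) hc (hmul ▸ (g⁻¹ * h).2)
    have hX' : (-X) * J l R + J l R * (-X)ᵀ = 0 := by
      rw [transpose_neg, neg_mul, mul_neg, ← neg_add, hX, neg_zero]
    obtain ⟨k, hk, W, hW⟩ := isLeadingTerm_of_mem_lieAlgebra hp h5 hH hX' m
    refine ⟨h * k, mul_mem hh hk,
      g * (V + W + (p : R) ^ m • ((X + (p : R) • V) * (-X + (p : R) • W))), ?_⟩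
    rw [← mul_inv_cancel_left g h, mul_assoc, Submonoid.coe_mul, Submonoid.coe_mul, hmul, hW, hV]
    have : (1 + (p : R) ^ (m + 1) • (X + (p : R) • V)) *
        (1 + (p : R) ^ (m + 1) • -X + (p : R) ^ (m + 1 + 1) • W) = 1 + (p : R) ^ (m + 1 + 1) •
        (V + W + (p : R) ^ m • ((X + (p : R) • V) * (-X + (p : R) • W))) := by
      simp only [mul_add, add_mul, smul_mul_assoc, mul_smul_comm, mul_one, one_mul]
      module
    rw [this, mul_add, mul_one, mul_smul_comm]

end

theorem mem_of_forall_congr_pow {l : Type*} [DecidableEq l] [Fintype l] {p : ℕ}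
    [Fact p.Prime] {H : Subgroup (symplecticGroup l ℤ_[p])}
    (hclosed : IsClosed (H : Set (symplecticGroup l ℤ_[p]))) {g : symplecticGroup l ℤ_[p]}
    (hg : ∀ m : ℕ, ∃ h ∈ H, ∃ Y,
      (h : Matrix (l ⊕ l) (l ⊕ l) ℤ_[p]) = g + (p : ℤ_[p]) ^ (m + 1) • Y) : g ∈ H := by
  choose h hh Y hY using hg
  refine hclosed.mem_of_tendsto (f := h) (b := Filter.atTop) ?_ (Filter.Eventually.of_forall hh)
  rw [tendsto_subtype_rng]
  refine tendsto_pi_nhds.2 fun i ↦ tendsto_pi_nhds.2 fun j ↦ ?_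
  rw [tendsto_iff_norm_sub_tendsto_zero]
  have hp1 : (p : ℝ)⁻¹ < 1 := inv_lt_one_of_one_lt₀ (mod_cast (Fact.out : p.Prime).one_lt)
  refine squeeze_zero (fun _ ↦ norm_nonneg _) (fun m ↦ ?_)
    ((Filter.tendsto_add_atTop_iff_nat 1).2
      (tendsto_pow_atTop_nhds_zero_of_lt_one (inv_nonneg.2 (Nat.cast_nonneg p)) hp1))
  rw [hY, Matrix.add_apply, add_sub_cancel_left, Matrix.smul_apply, smul_eq_mul, norm_mul,
    norm_pow, PadicInt.norm_p]
  exact mul_le_of_le_one_right (by positivity) (PadicInt.norm_le_one _)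

theorem exists_eq_add_smul_of_map_toZMod_eq {ι κ : Type*} {p : ℕ} [Fact p.Prime]
    {A B : Matrix ι κ ℤ_[p]} (h : A.map PadicInt.toZMod = B.map PadicInt.toZMod) :
    ∃ Y, A = B + (p : ℤ_[p]) • Y := by
  have hdvd (i j) : (p : ℤ_[p]) ∣ A i j - B i j := by
    rw [← Ideal.mem_span_singleton, ← PadicInt.maximalIdeal_eq_span_p, ← PadicInt.ker_toZMod,
      RingHom.mem_ker, map_sub, sub_eq_zero]
    exact congrFun₂ h i j
  choose Y hY using hdvd
  refine ⟨Matrix.of Y, ?_⟩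
  ext1 i j
  simp [← hY]

theorem stmt0 (n : ℕ) (hn : 1 ≤ n) (ℓ : ℕ) [Fact (Nat.Prime ℓ)] (hℓ : 5 ≤ ℓ)
    (H : Subgroup (Matrix.symplecticGroup (Fin n) ℤ_[ℓ]))
    (hclosed : IsClosed (H : Set (Matrix.symplecticGroup (Fin n) ℤ_[ℓ])))
    (hsurj : ∀ g : Matrix.symplecticGroup (Fin n) (ZMod ℓ), ∃ h ∈ H,
      (↑h : Matrix (Fin n ⊕ Fin n) (Fin n ⊕ Fin n) ℤ_[ℓ]).map (PadicInt.toZMod) = ↑g) :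
    H = ⊤ := by
  have htwo : IsUnit (2 : ℤ_[ℓ]) := by
    rw [PadicInt.isUnit_iff]
    have := (PadicInt.norm_natCast_eq_one_iff (p := ℓ) (n := 2)).2
      ((Nat.coprime_primes Fact.out Nat.prime_two).2 (by lia))
    exact_mod_cast this
  obtain ⟨c, hc⟩ := htwo.exists_right_inv
  refine (Subgroup.eq_top_iff' H).2 fun g ↦ mem_of_forall_congr_pow hclosed
    (exists_mem_congr_pow Fact.out hℓ hc (fun g ↦ ?_) g)
  obtain ⟨h, hh, hg⟩ := hsurj ⟨_, SymplecticGroup.map_mem g.2 PadicInt.toZMod⟩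
  exact ⟨h, hh, exists_eq_add_smul_of_map_toZMod_eq hg⟩
end

section
/- Let n ≥ 1 be an integer and ℓ ≥ 5 a prime. Let G be a closed subgroup of GL_{2n}(ℤ_ℓ) each of whose elements g is a symplectic similitude, i.e., for every g ∈ G there exists a unit ν(g) ∈ ℤ_ℓ^× with gᵀ J g = ν(g) J, where J is the standard symplectic matrix. If the image of G under entrywise reduction modulo ℓ contains Sp_{2n}(F_ℓ), then the closure of the commutator subgroup of G equals Sp_{2n}(ℤ_ℓ). -/
open Matrix

theorem exists_one_add_pow_eq_s1 {A : Type*} [Ring A] (u : A) (m : ℕ) :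
    ∃ q : A, (1 + u) ^ m = 1 + m * u + (m.choose 2) * u ^ 2 + (m.choose 3) * u ^ 3 + u ^ 4 * q := by
  have key : ∃ q : Polynomial ℤ, (1 + Polynomial.X) ^ m =
      1 + (m : Polynomial ℤ) * Polynomial.X + (m.choose 2 : Polynomial ℤ) * Polynomial.X ^ 2 +
      (m.choose 3 : Polynomial ℤ) * Polynomial.X ^ 3 + Polynomial.X ^ 4 * q := by
    induction m with
    | zero => exact ⟨0, by simp⟩
    | succ m ih =>
      obtain ⟨q, hq⟩ := ih
      refine ⟨(m.choose 3 : Polynomial ℤ) + q * (1 + Polynomial.X), ?_⟩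
      rw [pow_succ, hq, Nat.choose_succ_succ' m 1, Nat.choose_succ_succ' m 2]
      push_cast [Nat.choose_one_right]
      ring
  obtain ⟨q, hq⟩ := key
  refine ⟨Polynomial.aeval u q, ?_⟩
  simpa using congrArg (Polynomial.aeval u) hq

theorem exists_one_add_pow_prime_eq {A : Type*} [Ring A] {p : ℕ} (hp : p.Prime) (hp5 : 5 ≤ p)
    (k : ℕ) {Z W : A} (hZ : Z ^ 2 = p * W) :
    ∃ Y : A, (1 + (p : A) ^ k * Z) ^ p = 1 + (p : A) ^ (k + 1) * (Z + p * Y) := by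
  obtain ⟨q, hq⟩ := exists_one_add_pow_eq_s1 ((p : A) ^ k * Z) p
  obtain ⟨a, ha⟩ := hp.dvd_choose_self (k := 2) (by norm_num) (by omega)
  obtain ⟨b, hb⟩ := hp.dvd_choose_self (k := 3) (by norm_num) (by omega)
  have c (j : ℕ) (x : A) : x * (p : A) ^ j = (p : A) ^ j * x :=
    (((Nat.cast_commute p x).pow_left j).eq).symm
  have h2 : ((p : A) ^ k * Z) ^ 2 = (p : A) ^ (2 * k + 1) * W := by
    rw [((Nat.cast_commute p Z).pow_left k).mul_pow, hZ, ← mul_assoc, ← pow_mul, ← pow_succ,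
      mul_comm k 2]
  have h3 : ((p : A) ^ k * Z) ^ 3 = (p : A) ^ (2 * k + 1) * (W * ((p : A) ^ k * Z)) := by
    rw [pow_succ, h2, mul_assoc]
  have h4 : ((p : A) ^ k * Z) ^ 4 = (p : A) ^ (2 * k + 1) * ((p : A) ^ (2 * k + 1) * (W * W)) := by
    rw [show 4 = 2 + 2 from rfl, pow_add, h2]
    simp only [mul_assoc]
    rw [← mul_assoc W, c, mul_assoc]
  refine ⟨(p : A) ^ k * (a * W) + (p : A) ^ k * (b * (W * ((p : A) ^ k * Z))) +
    (p : A) ^ (2 * k) * ((p : A) ^ k * (W * W * q)), ?_⟩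
  rw [hq, h2, h3, h4, ha, hb]
  push_cast
  have ca (x : A) : (a : A) * ((p : A) ^ (2 * k + 1) * x) = (p : A) ^ (2 * k + 1) * (a * x) := by
    rw [← mul_assoc, c, mul_assoc]
  have cb (x : A) : (b : A) * ((p : A) ^ (2 * k + 1) * x) = (p : A) ^ (2 * k + 1) * (b * x) := by
    rw [← mul_assoc, c, mul_assoc]
  simp only [mul_assoc, mul_add, ca, cb]
  simp only [← mul_assoc (p : A), ← mul_assoc ((p : A) ^ _), ← pow_succ', ← pow_add]
  ring_nf
  simp only [add_assoc]

/-- The symplectic form. -/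
def sform {l R : Type*} [Fintype l] [DecidableEq l] [CommRing R] (x y : l ⊕ l → R) : R :=
  x ⬝ᵥ J l R *ᵥ y

section form

variable {l R : Type*} [Fintype l] [DecidableEq l] [CommRing R]

theorem sform_eq (x y : l ⊕ l → R) :
    sform x y = ∑ i, (x (.inr i) * y (.inl i) - x (.inl i) * y (.inr i)) := by
  simp [sform, J, Matrix.mulVec, dotProduct, Fintype.sum_sum_type, Matrix.one_apply,
    Matrix.neg_apply, sub_eq_neg_add, Finset.sum_add_distrib]

theorem sform_self (x : l ⊕ l → R) : sform x x = 0 := by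
  rw [sform_eq]; exact Finset.sum_eq_zero fun i _ => by ring

theorem sform_swap (x y : l ⊕ l → R) : sform x y = - sform y x := by
  rw [sform_eq, sform_eq, ← Finset.sum_neg_distrib]; exact Finset.sum_congr rfl fun i _ => by ring

theorem sform_add_left (x y z : l ⊕ l → R) : sform (x + y) z = sform x z + sform y z := by
  simp [sform, add_dotProduct]

theorem sform_sub_left (x y z : l ⊕ l → R) : sform (x - y) z = sform x z - sform y z := by
  simp [sform, sub_dotProduct]

theorem sform_smul_left (a : R) (x z : l ⊕ l → R) : sform (a • x) z = a * sform x z := by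
  simp [sform]

theorem sform_add_right (x y z : l ⊕ l → R) : sform x (y + z) = sform x y + sform x z := by
  simp [sform, mulVec_add]

theorem sform_sub_right (x y z : l ⊕ l → R) : sform x (y - z) = sform x y - sform x z := by
  simp [sform, mulVec_sub]

theorem sform_smul_right (a : R) (x z : l ⊕ l → R) : sform x (a • z) = a * sform x z := by
  simp [sform, mulVec_smul]

theorem exists_sform_ne_zero {v : l ⊕ l → R} (hv : v ≠ 0) : ∃ w, sform w v ≠ 0 := by
  by_contra! h
  apply hv
  have : J l R *ᵥ v = 0 := by
    ext i
    simpa [sform] using h (Pi.single i 1)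
  calc v = -((J l R * J l R) *ᵥ v) := by simp [J_squared, neg_mulVec]
    _ = 0 := by rw [← mulVec_mulVec, this]; simp

theorem mem_symplecticGroup_iff_sform {A : Matrix (l ⊕ l) (l ⊕ l) R} :
    A ∈ symplecticGroup l R ↔ ∀ x y, sform (A *ᵥ x) (A *ᵥ y) = sform x y := by
  have key (x y) : sform (A *ᵥ x) (A *ᵥ y) = x ⬝ᵥ (Aᵀ * J l R * A) *ᵥ y := by
    simp [sform, ← mulVec_mulVec, dotProduct_mulVec, vecMul_transpose]
  rw [SymplecticGroup.mem_iff']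
  constructor
  · intro h x y
    rw [key, h]; rfl
  · intro h
    ext i j
    have := h (Pi.single i 1) (Pi.single j 1)
    rw [key] at this
    simpa [sform] using this

/-- The symplectic transvection `x ↦ x + a ω(v, x) v`. -/
def symplecticTransvection (v : l ⊕ l → R) (a : R) : Matrix (l ⊕ l) (l ⊕ l) R :=
  1 + a • (vecMulVec v v * J l R)

theorem symplecticTransvection_mulVec (v : l ⊕ l → R) (a : R) (x : l ⊕ l → R) :
    symplecticTransvection v a *ᵥ x = x + (a * sform v x) • v := by
  ext i
  simp [symplecticTransvection, add_mulVec, smul_mulVec, ← mulVec_mulVec, vecMulVec_mulVec, sform]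
  ring

theorem symplecticTransvection_mem (v : l ⊕ l → R) (a : R) :
    symplecticTransvection v a ∈ symplecticGroup l R := by
  rw [mem_symplecticGroup_iff_sform]
  intro x y
  simp only [symplecticTransvection_mulVec, sform_add_left, sform_add_right, sform_smul_left,
    sform_smul_right, sform_self, sform_swap x v]
  ring

/-- Symplectic transvections as elements of the symplectic group. -/
def spTrans (v : l ⊕ l → R) (a : R) : symplecticGroup l R :=
  ⟨symplecticTransvection v a, symplecticTransvection_mem v a⟩

theorem symplecticGroup_ext {g h : symplecticGroup l R} (H : ∀ x, g.1 *ᵥ x = h.1 *ᵥ x) : g = h :=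
  Subtype.ext (Matrix.ext_of_mulVec_single fun _ => H _)

theorem spTrans_mul (v : l ⊕ l → R) (a b : R) :
    spTrans v a * spTrans v b = spTrans v (a + b) := by
  apply symplecticGroup_ext
  intro x
  simp only [spTrans, Submonoid.coe_mul, ← mulVec_mulVec, symplecticTransvection_mulVec,
    sform_add_right, sform_smul_right, sform_self, add_assoc, ← add_smul]
  congr 2
  ring

theorem spTrans_zero (v : l ⊕ l → R) : spTrans v 0 = 1 :=
  symplecticGroup_ext fun x => by simp [spTrans, symplecticTransvection_mulVec]

theorem spTrans_inv (v : l ⊕ l → R) (a : R) : (spTrans v a)⁻¹ = spTrans v (-a) :=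
  inv_eq_of_mul_eq_one_right (by rw [spTrans_mul, add_neg_cancel, spTrans_zero])

theorem spTrans_conj (g : symplecticGroup l R) (v : l ⊕ l → R) (a : R) :
    g * spTrans v a * g⁻¹ = spTrans (g.1 *ᵥ v) a := by
  rw [mul_inv_eq_iff_eq_mul]
  apply symplecticGroup_ext
  intro x
  simp only [spTrans, Submonoid.coe_mul, ← mulVec_mulVec, symplecticTransvection_mulVec,
    mem_symplecticGroup_iff_sform.1 g.2, mulVec_add, mulVec_smul]

theorem spTrans_smul (c : R) (v : l ⊕ l → R) (a : R) :
    spTrans (c • v) a = spTrans v (c ^ 2 * a) := by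
  apply symplecticGroup_ext
  intro x
  simp only [spTrans, symplecticTransvection_mulVec, sform_smul_left, smul_smul]
  congr 2
  ring

end form

section field

variable {l K : Type*} [Fintype l] [DecidableEq l] [Field K]

theorem spTrans_mulVec_eq {x y : l ⊕ l → K} (h : sform y x ≠ 0) :
    (spTrans (y - x) (sform y x)⁻¹).1 *ᵥ x = y := by
  simp [spTrans, symplecticTransvection_mulVec, sform_sub_left, sform_self, h]

theorem exists_mulVec_eq_smul (v : l ⊕ l → K) {c : K} (hc : c ≠ 0) :
    ∃ g : symplecticGroup l K, g.1 *ᵥ v = c • v := by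
  by_cases hv : v = 0
  · exact ⟨1, by simp [hv]⟩
  obtain ⟨w, hw⟩ := exists_sform_ne_zero hv
  have hw' : sform (c • v) w ≠ 0 := by
    rw [sform_smul_left, sform_swap]
    simp [hc, hw]
  refine ⟨spTrans (c • v - w) (sform (c • v) w)⁻¹ * spTrans (w - v) (sform w v)⁻¹, ?_⟩
  rw [Submonoid.coe_mul, ← mulVec_mulVec, spTrans_mulVec_eq hw, spTrans_mulVec_eq hw']

open scoped commutatorElement in
theorem spTrans_mem_commutator {c : K} (hc : c ≠ 0) (hc1 : c ^ 2 ≠ 1) (v : l ⊕ l → K) (a : K) :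
    spTrans v a ∈ commutator (symplecticGroup l K) := by
  obtain ⟨g, hg⟩ := exists_mulVec_eq_smul v hc
  have hc2 : c ^ 2 - 1 ≠ 0 := sub_ne_zero.2 hc1
  have : spTrans v a = ⁅g, spTrans v (a / (c ^ 2 - 1))⁆ := by
    rw [commutatorElement_def, spTrans_conj, hg, spTrans_smul, spTrans_inv, spTrans_mul]
    congr 1
    field_simp
    ring
  rw [this]
  exact Subgroup.commutator_mem_commutator (Subgroup.mem_top _) (Subgroup.mem_top _)

/-- The subspace of vectors fixed by a matrix. -/
def fixedSpace (g : Matrix (l ⊕ l) (l ⊕ l) K) : Submodule K (l ⊕ l → K) :=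
  LinearMap.ker (g - 1).mulVecLin

theorem mem_fixedSpace {g : Matrix (l ⊕ l) (l ⊕ l) K} {x : l ⊕ l → K} :
    x ∈ fixedSpace g ↔ g *ᵥ x = x := by
  simp [fixedSpace, sub_eq_zero]

theorem fixedSpace_le_spTrans_mul (g : symplecticGroup l K) (v : l ⊕ l → K) (a : K) :
    fixedSpace g.1 ≤ fixedSpace (spTrans (g.1 *ᵥ v - v) a * g).1 := by
  intro x hx
  rw [mem_fixedSpace] at hx ⊢
  have : sform (g.1 *ᵥ v - v) x = 0 := by
    conv_lhs => rw [sform_sub_left, ← hx, mem_symplecticGroup_iff_sform.1 g.2, hx]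
    simp
  simp [← mulVec_mulVec, hx, spTrans, symplecticTransvection_mulVec, this]

theorem spTrans_closure : Subgroup.closure (Set.range fun p : (l ⊕ l → K) × K => spTrans p.1 p.2)
    = ⊤ := by
  set N := Subgroup.closure (Set.range fun p : (l ⊕ l → K) × K => spTrans p.1 p.2)
  have hN (v : l ⊕ l → K) (a : K) : spTrans v a ∈ N := Subgroup.subset_closure ⟨(v, a), rfl⟩
  rw [eq_top_iff]
  rintro g -
  induction hF : fixedSpace g.1 using WellFoundedGT.induction generalizing g with
  | ind F ih =>
  subst hF
  have nonhyp (h : symplecticGroup l K) (hle : fixedSpace g.1 ≤ fixedSpace h.1) (v : l ⊕ l → K)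
      (hv : sform v (h.1 *ᵥ v) ≠ 0) : h ∈ N := by
    set T := spTrans (h.1 *ᵥ v - v) (sform v (h.1 *ᵥ v))⁻¹ with hT
    have hfix : v ∈ fixedSpace (T * h).1 := by
      rw [mem_fixedSpace, Submonoid.coe_mul, ← mulVec_mulVec, hT]
      simp only [spTrans, symplecticTransvection_mulVec, sform_sub_left, sform_self]
      rw [zero_sub, mul_neg, inv_mul_cancel₀ hv]
      module
    have hnot : v ∉ fixedSpace g.1 := fun hmem => by
      rw [mem_fixedSpace.1 (hle hmem), sform_self] at hv
      exact hv rfl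
    have hlt : fixedSpace g.1 < fixedSpace (T * h).1 :=
      lt_of_le_of_ne (hle.trans (fixedSpace_le_spTrans_mul h v _)) fun e => hnot (e ▸ hfix)
    exact (N.mul_mem_cancel_left (hN _ _)).1 (ih _ hlt rfl)
  by_cases hyp : ∃ v, sform v (g.1 *ᵥ v) ≠ 0
  · obtain ⟨v, hv⟩ := hyp
    exact nonhyp g le_rfl v hv
  push Not at hyp
  by_cases hg : ∀ v, g.1 *ᵥ v = v
  · rw [show g = 1 from symplecticGroup_ext fun x => by simp [hg x]]
    exact N.one_mem
  push Not at hg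
  obtain ⟨v, hv⟩ := hg
  obtain ⟨w, hw⟩ := exists_sform_ne_zero (sub_ne_zero.2 hv)
  refine (N.mul_mem_cancel_left (hN (g.1 *ᵥ v - v) 1)).1
    (nonhyp _ (fixedSpace_le_spTrans_mul g v 1) w ?_)
  have e := hyp (v + w)
  simp only [mulVec_add, sform_add_left, sform_add_right, hyp, zero_add, add_zero] at e
  have : sform w ((spTrans (g.1 *ᵥ v - v) 1 * g).1 *ᵥ w) = sform w (g.1 *ᵥ v - v) ^ 2 := by
    rw [Submonoid.coe_mul, ← mulVec_mulVec]
    simp only [spTrans, symplecticTransvection_mulVec, sform_add_right, sform_sub_left,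
      sform_sub_right, sform_smul_right, hyp, mem_symplecticGroup_iff_sform.1 g.2]
    rw [eq_neg_of_add_eq_zero_left e, sform_swap v w]
    ring
  rw [this]
  exact pow_ne_zero 2 hw

theorem commutator_symplecticGroup_eq_top {c : K} (hc : c ≠ 0) (hc1 : c ^ 2 ≠ 1) :
    commutator (symplecticGroup l K) = ⊤ := by
  rw [eq_top_iff, ← spTrans_closure, Subgroup.closure_le]
  rintro _ ⟨p, rfl⟩
  exact spTrans_mem_commutator hc hc1 _ _

end field

theorem isSymm_mem_span_vecMulVec {m K : Type*} [Fintype m] [DecidableEq m] [Field K]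
    (h2 : (2 : K) ≠ 0) {S : Matrix m m K} (hS : S.IsSymm) :
    S ∈ Submodule.span K (Set.range fun v : m → K => vecMulVec v v) := by
  set P := Submodule.span K (Set.range fun v : m → K => vecMulVec v v)
  have hP (v : m → K) : vecMulVec v v ∈ P := Submodule.subset_span ⟨v, rfl⟩
  have key : S = ∑ i, ∑ j, (2⁻¹ * S i j) •
      (vecMulVec (Pi.single i 1 + Pi.single j 1) (Pi.single i 1 + Pi.single j 1)
        - vecMulVec (Pi.single i 1) (Pi.single i 1) - vecMulVec (Pi.single j 1) (Pi.single j 1)) := by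
    have e (i j : m) : (vecMulVec (Pi.single i 1 + Pi.single j 1) (Pi.single i 1 + Pi.single j 1)
        - vecMulVec (Pi.single i 1) (Pi.single i 1)
        - vecMulVec (Pi.single j 1) (Pi.single j 1) : Matrix m m K)
        = Matrix.single i j 1 + Matrix.single j i 1 := by
      rw [add_vecMulVec, vecMulVec_add, vecMulVec_add]
      simp only [← Matrix.single_eq_single_vecMulVec_single]
      abel
    simp only [e, smul_add, Finset.sum_add_distrib, Matrix.smul_single, smul_eq_mul, mul_one]
    rw [Finset.sum_comm (f := fun i j => Matrix.single j i (2⁻¹ * S i j))]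
    simp only [hS.apply]
    rw [← two_nsmul, Finset.smul_sum]
    simp only [Finset.smul_sum, Matrix.smul_single, nsmul_eq_mul, Nat.cast_ofNat, ← mul_assoc,
      mul_inv_cancel₀ h2, one_mul]
    exact matrix_eq_sum_single S
  rw [key]
  exact P.sum_mem fun i _ => P.sum_mem fun j _ => P.smul_mem _
    (P.sub_mem (P.sub_mem (hP _) (hP _)) (hP _))

theorem natCast_matrix_zmod {m : Type*} [DecidableEq m] {p : ℕ} : (p : Matrix m m (ZMod p)) = 0 := by
  rw [← Matrix.diagonal_natCast]
  simp

section padic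
variable {m : Type*} [Fintype m] [DecidableEq m] {p : ℕ} [Fact p.Prime]

theorem exists_eq_natCast_mul {A : Matrix m m ℤ_[p]}
    (hA : (PadicInt.toZMod (p := p)).mapMatrix A = 0) : ∃ B, A = (p : Matrix m m ℤ_[p]) * B := by
  have h (i j) : ∃ b : ℤ_[p], A i j = p * b := by
    have : A i j ∈ RingHom.ker (PadicInt.toZMod (p := p)) := congrFun₂ hA i j
    rwa [PadicInt.ker_toZMod, PadicInt.maximalIdeal_eq_span_p, Ideal.mem_span_singleton] at this
  choose B hB using h
  refine ⟨Matrix.of B, ?_⟩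
  rw [← nsmul_eq_mul]
  ext i j
  simp [hB]

theorem natCast_pow_mul_cancel {k : ℕ} {A B : Matrix m m ℤ_[p]}
    (h : (p : Matrix m m ℤ_[p]) ^ k * A = (p : Matrix m m ℤ_[p]) ^ k * B) : A = B := by
  have hp : ((p : ℤ_[p])) ≠ 0 := Nat.cast_ne_zero.2 (Fact.out : p.Prime).ne_zero
  rw [← Nat.cast_pow, ← nsmul_eq_mul, ← nsmul_eq_mul] at h
  ext i j
  have := congrFun₂ h i j
  simpa [hp] using this

theorem tendsto_of_sub_eq_natCast_pow_mul {A : ℕ → Matrix m m ℤ_[p]} {B : Matrix m m ℤ_[p]}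
    (h : ∀ k, ∃ Y, B - A k = (p : Matrix m m ℤ_[p]) ^ k * Y) :
    Filter.Tendsto A Filter.atTop (nhds B) := by
  choose Y hY using h
  refine tendsto_pi_nhds.2 fun i => tendsto_pi_nhds.2 fun j => ?_
  rw [tendsto_iff_norm_sub_tendsto_zero]
  have hp : (1 : ℝ) < p := by exact_mod_cast (Fact.out : p.Prime).one_lt
  refine squeeze_zero (fun _ => norm_nonneg _) (fun k => ?_)
    (tendsto_pow_atTop_nhds_zero_of_lt_one (r := (p : ℝ)⁻¹) (by positivity) (inv_lt_one_of_one_lt₀ hp))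
  have e := congrFun₂ (hY k) i j
  rw [← Nat.cast_pow, ← nsmul_eq_mul] at e
  rw [norm_sub_rev]
  simp only [Matrix.sub_apply, Matrix.smul_apply, nsmul_eq_mul] at e
  rw [e]
  push_cast
  rw [norm_mul, norm_pow, PadicInt.norm_p]
  exact mul_le_of_le_one_right (by positivity) (PadicInt.norm_le_one _)

/-- The elements `X` such that `H` contains a lift of `1 + p ^ k X`. -/
def congruenceLayer (H : Subgroup (GL m ℤ_[p])) (k : ℕ) (hk : 1 ≤ k) :
    AddSubmonoid (Matrix m m (ZMod p)) where
  carrier := {X | ∃ h ∈ H, ∃ Z : Matrix m m ℤ_[p],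
    h.1 = 1 + (p : Matrix m m ℤ_[p]) ^ k * Z ∧ (PadicInt.toZMod (p := p)).mapMatrix Z = X}
  zero_mem' := ⟨1, H.one_mem, 0, by simp, by simp⟩
  add_mem' := by
    rintro _ _ ⟨h, hh, Z, hZ, rfl⟩ ⟨h', hh', Z', hZ', rfl⟩
    refine ⟨h * h', H.mul_mem hh hh', Z + Z' + (p : Matrix m m ℤ_[p]) ^ k * (Z * Z'), ?_, ?_⟩
    · have c : Z * (p : Matrix m m ℤ_[p]) ^ k = (p : Matrix m m ℤ_[p]) ^ k * Z :=
        (((Nat.cast_commute p Z).pow_left k).eq).symm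
      rw [Units.val_mul, hZ, hZ']
      simp only [mul_add, add_mul, mul_one, one_mul, mul_assoc]
      rw [← mul_assoc Z, c]
      simp only [mul_assoc, add_assoc]
    · rw [map_add, map_add, map_mul _ (_ ^ k), map_pow, map_natCast, natCast_matrix_zmod,
        zero_pow (by omega), zero_mul, add_zero]

/-- The elements `X` such that `H` contains a lift of `1 + p ^ k X`, as a subspace. -/
def congruenceSubspace (H : Subgroup (GL m ℤ_[p])) (k : ℕ) (hk : 1 ≤ k) :
    Submodule (ZMod p) (Matrix m m (ZMod p)) where
  toAddSubmonoid := congruenceLayer H k hk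
  smul_mem' a X hX := by
    rw [← ZMod.natCast_zmod_val a, Nat.cast_smul_eq_nsmul]
    exact (congruenceLayer H k hk).nsmul_mem hX _

theorem exists_pow_lift {H : Subgroup (GL m ℤ_[p])} (hp : 5 ≤ p) {X : Matrix m m (ZMod p)}
    (hX : X ^ 2 = 0) (h0 : ∃ h ∈ H, (PadicInt.toZMod (p := p)).mapMatrix h.1 = 1 + X) (k : ℕ) :
    ∃ h ∈ H, ∃ Z : Matrix m m ℤ_[p],
      h.1 = 1 + (p : Matrix m m ℤ_[p]) ^ k * Z ∧ (PadicInt.toZMod (p := p)).mapMatrix Z = X := by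
  induction k with
  | zero =>
    obtain ⟨h, hh, e⟩ := h0
    exact ⟨h, hh, h.1 - 1, by simp, by rw [map_sub, e, map_one, add_sub_cancel_left]⟩
  | succ k ih =>
    obtain ⟨h, hh, Z, hZ, rfl⟩ := ih
    rw [← map_pow] at hX
    obtain ⟨W, hW⟩ := exists_eq_natCast_mul hX
    obtain ⟨Y, hY⟩ := exists_one_add_pow_prime_eq Fact.out hp k hW
    refine ⟨h ^ p, H.pow_mem hh p, Z + p * Y, by rw [Units.val_pow_eq_pow_val, hZ, hY], ?_⟩
    rw [map_add, map_mul, map_natCast, natCast_matrix_zmod, zero_mul, add_zero]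

end padic

section symplectic
variable {l : Type*} [Fintype l] [DecidableEq l] {p : ℕ} [Fact p.Prime]

theorem mem_congruenceSubspace (hp : 5 ≤ p) {H : Subgroup (GL (l ⊕ l) ℤ_[p])}
    (hsurj : ∀ s : symplecticGroup l (ZMod p), ∃ h ∈ H,
      (PadicInt.toZMod (p := p)).mapMatrix h.1 = s.1)
    (k : ℕ) (hk : 1 ≤ k) {X : Matrix (l ⊕ l) (l ⊕ l) (ZMod p)} (hX : Xᵀ * J l _ + J l _ * X = 0) :
    X ∈ congruenceSubspace H k hk := by
  have h2 : (2 : ZMod p) ≠ 0 := by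
    intro h
    have := (ZMod.natCast_eq_zero_iff 2 p).1 (by exact_mod_cast h)
    have := Nat.le_of_dvd (by norm_num) this
    omega
  have hS : (J l (ZMod p) * X).IsSymm := by
    rw [Matrix.IsSymm, transpose_mul, J_transpose, mul_neg]
    exact neg_eq_of_add_eq_zero_right hX
  let f : Matrix (l ⊕ l) (l ⊕ l) (ZMod p) →ₗ[ZMod p] Matrix (l ⊕ l) (l ⊕ l) (ZMod p) :=
    LinearMap.mulRight (ZMod p) (J l (ZMod p))
  have hS' : (X * J l (ZMod p)).IsSymm := by
    have : X * J l (ZMod p) = - (J l _ * (J l _ * X) * J l _) := by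
      rw [← mul_assoc, J_squared]; simp
    rw [this, Matrix.IsSymm, transpose_neg, transpose_mul, transpose_mul, hS.eq]
    simp [mul_assoc]
  have hle : Submodule.span (ZMod p) (Set.range fun v : l ⊕ l → ZMod p => vecMulVec v v) ≤
      (congruenceSubspace H k hk).comap f := by
    rw [Submodule.span_le]
    rintro _ ⟨v, rfl⟩
    refine exists_pow_lift hp ?_ ?_ k
    · have : v ᵥ* J l (ZMod p) ⬝ᵥ v = 0 := by
        rw [← dotProduct_mulVec]
        exact sform_self v
      simp only [f, LinearMap.mulRight_apply, pow_two, vecMulVec_mul]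
      rw [vecMul_vecMulVec, this]
      simp
    · obtain ⟨h, hh, e⟩ := hsurj (spTrans v 1)
      exact ⟨h, hh, by rw [e]; simp [f, spTrans, symplecticTransvection]⟩
  have := hle (isSymm_mem_span_vecMulVec h2 hS')
  have := (congruenceSubspace H k hk).neg_mem this
  simpa [f, mul_assoc, J_squared] using this

theorem exists_sub_eq_natCast_pow_mul (hp : 5 ≤ p) {H : Subgroup (GL (l ⊕ l) ℤ_[p])}
    (hH : ∀ h ∈ H, h.1 ∈ symplecticGroup l ℤ_[p])
    (hsurj : ∀ s : symplecticGroup l (ZMod p), ∃ h ∈ H,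
      (PadicInt.toZMod (p := p)).mapMatrix h.1 = s.1)
    {g : GL (l ⊕ l) ℤ_[p]} (hg : g.1 ∈ symplecticGroup l ℤ_[p]) (k : ℕ) :
    ∃ h ∈ H, ∃ Y, g.1 - h.1 = (p : Matrix (l ⊕ l) (l ⊕ l) ℤ_[p]) ^ k * Y := by
  obtain _ | k := k
  · exact ⟨1, H.one_mem, g.1 - 1, by simp⟩
  induction k with
  | zero =>
    obtain ⟨h, hh, e⟩ := hsurj ⟨_, SymplecticGroup.map_mem hg (PadicInt.toZMod (p := p))⟩
    obtain ⟨Y, hY⟩ := exists_eq_natCast_mul (A := g.1 - h.1) (by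
      rw [map_sub, e]; simp)
    exact ⟨h, hh, Y, by simpa using hY⟩
  | succ k ih =>
    obtain ⟨h, hh, Y, hY⟩ := ih
    have c (A : Matrix (l ⊕ l) (l ⊕ l) ℤ_[p]) (j : ℕ) : A * (p : Matrix (l ⊕ l) (l ⊕ l) ℤ_[p]) ^ j
        = (p : Matrix (l ⊕ l) (l ⊕ l) ℤ_[p]) ^ j * A :=
      (((Nat.cast_commute p A).pow_left j).eq).symm
    set Z := h⁻¹.1 * Y with hZ
    have e1 : (h⁻¹ * g).1 = 1 + (p : Matrix (l ⊕ l) (l ⊕ l) ℤ_[p]) ^ (k + 1) * Z := by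
      rw [hZ, ← mul_assoc, ← c, mul_assoc, ← hY, mul_sub, Units.inv_mul, Units.val_mul]
      abel
    have e2 : (h⁻¹ * g).1 ∈ symplecticGroup l ℤ_[p] := by
      rw [Units.val_mul]
      exact mul_mem (hH _ (H.inv_mem hh)) hg
    rw [e1, SymplecticGroup.mem_iff'] at e2
    have e3 : Zᵀ * J l _ + J l _ * Z +
        (p : Matrix (l ⊕ l) (l ⊕ l) ℤ_[p]) ^ (k + 1) * (Zᵀ * J l _ * Z) = 0 := by
      apply natCast_pow_mul_cancel (k := k + 1)
      have e4 : ((p : Matrix (l ⊕ l) (l ⊕ l) ℤ_[p]) ^ (k + 1))ᵀ =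
        (p : Matrix (l ⊕ l) (l ⊕ l) ℤ_[p]) ^ (k + 1) := by
          rw [transpose_pow, transpose_natCast]
      rw [transpose_add, transpose_mul, e4, transpose_one, c] at e2
      simp only [add_mul, mul_add, one_mul, mul_one, mul_assoc] at e2 ⊢
      rw [← mul_assoc (J l ℤ_[p]), c, mul_assoc _ (J l ℤ_[p]), ← mul_assoc Zᵀ (_ ^ _), c] at e2
      rw [add_assoc, add_eq_left] at e2
      simp only [mul_assoc, mul_zero] at e2 ⊢
      rw [← e2, add_assoc]
    have e5 := congrArg (PadicInt.toZMod (p := p)).mapMatrix e3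
    obtain ⟨h', hh', Z', hZ', e6⟩ := mem_congruenceSubspace hp hsurj (k + 1) (by omega)
      (X := (PadicInt.toZMod (p := p)).mapMatrix Z) (by
        simp only [map_add, map_mul, map_pow, map_natCast, natCast_matrix_zmod, map_zero] at e5
        rw [zero_pow (by omega), zero_mul, add_zero] at e5
        simpa [RingHom.mapMatrix_apply, transpose_map] using e5)
    obtain ⟨W, hW⟩ := exists_eq_natCast_mul (A := Z - Z') (by rw [map_sub, e6, sub_self])
    refine ⟨h * h', H.mul_mem hh hh', h.1 * W, ?_⟩
    have : g.1 = h.1 * (h⁻¹ * g).1 := by simp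
    rw [this, e1, Units.val_mul, hZ', ← mul_sub, add_sub_add_left_eq_sub, ← mul_sub, hW, ← mul_assoc,
      ← mul_assoc, c, ← mul_assoc, pow_succ _ (k + 1), mul_assoc, mul_assoc, mul_assoc]
    rw [mul_assoc, ← mul_assoc h.1, ← Nat.cast_comm, mul_assoc]

theorem GL_tendsto_of_sub_eq_natCast_pow_mul {A : ℕ → GL (l ⊕ l) ℤ_[p]} {B : GL (l ⊕ l) ℤ_[p]}
    (h : ∀ k, ∃ Y, B.1 - (A k).1 = (p : Matrix (l ⊕ l) (l ⊕ l) ℤ_[p]) ^ k * Y) :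
    Filter.Tendsto A Filter.atTop (nhds B) := by
  rw [Units.isEmbedding_embedProduct.tendsto_nhds_iff]
  refine Filter.Tendsto.prodMk_nhds (tendsto_of_sub_eq_natCast_pow_mul h)
    ((MulOpposite.continuous_op.tendsto _).comp (tendsto_of_sub_eq_natCast_pow_mul fun k => ?_))
  obtain ⟨Y, hY⟩ := h k
  refine ⟨-((A k)⁻¹.1 * Y * B⁻¹.1), ?_⟩
  have : B⁻¹.1 - (A k)⁻¹.1 = -((A k)⁻¹.1 * (B.1 - (A k).1) * B⁻¹.1) := by
    simp [mul_sub, sub_mul, mul_assoc]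
  rw [this, hY, ← mul_assoc, ← ((Nat.cast_commute p (A k)⁻¹.1).pow_left k).eq]
  simp [mul_assoc]

open scoped commutatorElement in
theorem commutatorElement_mem_symplecticGroup {R : Type*} [CommRing R] {g h : GL (l ⊕ l) R}
    {a b : R} (hg : g.1ᵀ * J l R * g.1 = a • J l R) (hh : h.1ᵀ * J l R * h.1 = b • J l R) :
    (⁅g, h⁆).1 ∈ symplecticGroup l R := by
  have key {g h : GL (l ⊕ l) R} {a b : R} (hg : g.1ᵀ * J l R * g.1 = a • J l R)
      (hh : h.1ᵀ * J l R * h.1 = b • J l R) :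
      (g * h).1ᵀ * J l R * (g * h).1 = (a * b) • J l R := by
    calc (g * h).1ᵀ * J l R * (g * h).1 = h.1ᵀ * (g.1ᵀ * J l R * g.1) * h.1 := by
          simp [mul_assoc]
      _ = (a * b) • J l R := by rw [hg]; simp [hh, mul_smul]
  set u := h * g with hu
  have e : ⁅g, h⁆ * u = g * h := by simp [commutatorElement_def, hu, mul_assoc]
  have h1 := key hg hh
  rw [← e, mul_comm a, ← key hh hg, ← hu, Units.val_mul, transpose_mul] at h1
  have hut : (u⁻¹.1)ᵀ * u.1ᵀ = 1 := by
    rw [← transpose_mul, ← Units.val_mul, mul_inv_cancel, Units.val_one, transpose_one]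
  rw [SymplecticGroup.mem_iff']
  calc (⁅g, h⁆).1ᵀ * J l R * (⁅g, h⁆).1
      = ((u⁻¹.1)ᵀ * u.1ᵀ) * ((⁅g, h⁆).1ᵀ * J l R * (⁅g, h⁆).1) * (u.1 * u⁻¹.1) := by
        rw [hut, Units.mul_inv, one_mul, mul_one]
    _ = (u⁻¹.1)ᵀ * (u.1ᵀ * (⁅g, h⁆).1ᵀ * J l R * ((⁅g, h⁆).1 * u.1)) * u⁻¹.1 := by
        simp only [mul_assoc]
    _ = ((u⁻¹.1)ᵀ * u.1ᵀ) * J l R * (u.1 * u⁻¹.1) := by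
        rw [h1]
        simp only [mul_assoc]
    _ = J l R := by rw [hut, Units.mul_inv, one_mul, mul_one]

theorem isClosed_symplecticGroup {R : Type*} [CommRing R] [TopologicalSpace R]
    [IsTopologicalRing R] [T2Space R] :
    IsClosed (symplecticGroup l R : Set (Matrix (l ⊕ l) (l ⊕ l) R)) :=
  isClosed_eq (f := fun A : Matrix (l ⊕ l) (l ⊕ l) R => A * J l R * Aᵀ) (by fun_prop)
    continuous_const

theorem exists_mem_commutator_map_eq (hp : 5 ≤ p) {G : Subgroup (GL (l ⊕ l) ℤ_[p])}
    (hsurj : ∀ s : symplecticGroup l (ZMod p), ∃ g ∈ G,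
      (PadicInt.toZMod (p := p)).mapMatrix g.1 = s.1) (s : symplecticGroup l (ZMod p)) :
    ∃ g ∈ ⁅G, G⁆, (PadicInt.toZMod (p := p)).mapMatrix g.1 = s.1 := by
  let φ : GL (l ⊕ l) ℤ_[p] →* GL (l ⊕ l) (ZMod p) :=
    Units.map (PadicInt.toZMod (p := p)).mapMatrix.toMonoidHom
  let ψ : symplecticGroup l (ZMod p) →* GL (l ⊕ l) (ZMod p) :=
    (Units.map (symplecticGroup l (ZMod p)).subtype).comp toUnits.toMonoidHom
  have hne (q : ℕ) (h0 : 0 < q) (hq : q < p) : (q : ZMod p) ≠ 0 := fun h =>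
    absurd (Nat.le_of_dvd h0 ((ZMod.natCast_eq_zero_iff q p).1 h)) (by omega)
  have htop : commutator (symplecticGroup l (ZMod p)) = ⊤ := by
    refine commutator_symplecticGroup_eq_top (c := 2) (by exact_mod_cast hne 2 (by omega) (by omega))
      fun h => hne 3 (by omega) (by omega) ?_
    push_cast
    linear_combination h
  have hle : ψ.range ≤ G.map φ := by
    rintro _ ⟨t, rfl⟩
    obtain ⟨g, hg, e⟩ := hsurj t
    exact ⟨g, hg, Units.ext e⟩
  have hmem : ψ s ∈ Subgroup.map φ ⁅G, G⁆ := by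
    rw [Subgroup.map_commutator]
    refine Subgroup.commutator_mono hle hle ?_
    rw [MonoidHom.range_eq_map, ← Subgroup.map_commutator]
    exact ⟨s, by rw [SetLike.mem_coe, ← commutator_def, htop]; trivial, rfl⟩
  obtain ⟨g, hg, e⟩ := hmem
  exact ⟨g, hg, congrArg Units.val e⟩

end symplectic

theorem stmt1 (n : ℕ) (hn : 1 ≤ n) (ℓ : ℕ) [Fact (Nat.Prime ℓ)] (hℓ : 5 ≤ ℓ)
    (G : Subgroup (GL (Fin n ⊕ Fin n) ℤ_[ℓ]))
    (hclosed : IsClosed (G : Set (GL (Fin n ⊕ Fin n) ℤ_[ℓ])))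
    (hsim : ∀ g ∈ G, ∃ ν : ℤ_[ℓ]ˣ,
      (↑g : Matrix (Fin n ⊕ Fin n) (Fin n ⊕ Fin n) ℤ_[ℓ])ᵀ * Matrix.J (Fin n) ℤ_[ℓ] * (↑g : Matrix (Fin n ⊕ Fin n) (Fin n ⊕ Fin n) ℤ_[ℓ])
        = (ν : ℤ_[ℓ]) • Matrix.J (Fin n) ℤ_[ℓ])
    (hsurj : ∀ s : Matrix.symplecticGroup (Fin n) (ZMod ℓ), ∃ g ∈ G,
      (↑g : Matrix (Fin n ⊕ Fin n) (Fin n ⊕ Fin n) ℤ_[ℓ]).map (PadicInt.toZMod) = ↑s) :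
    closure ((⁅G, G⁆ : Subgroup (GL (Fin n ⊕ Fin n) ℤ_[ℓ])) : Set (GL (Fin n ⊕ Fin n) ℤ_[ℓ]))
      = {g : GL (Fin n ⊕ Fin n) ℤ_[ℓ] |
          (↑g : Matrix (Fin n ⊕ Fin n) (Fin n ⊕ Fin n) ℤ_[ℓ]) ∈ Matrix.symplecticGroup (Fin n) ℤ_[ℓ]} := by
  have hmem : ∀ h ∈ ⁅G, G⁆, h.1 ∈ symplecticGroup (Fin n) ℤ_[ℓ] := by
    let S : Subgroup (GL (Fin n ⊕ Fin n) ℤ_[ℓ]) :=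
      { (symplecticGroup (Fin n) ℤ_[ℓ]).comap (Units.coeHom _) with
        inv_mem' := fun {x} hx => by
          have := (⟨x.1, hx⟩ : symplecticGroup (Fin n) ℤ_[ℓ])⁻¹.2
          rwa [SymplecticGroup.coe_inv', ← coe_units_inv] at this }
    have hle : ⁅G, G⁆ ≤ S := Subgroup.commutator_le.2 fun g hg h hh => by
      obtain ⟨a, ha⟩ := hsim g hg
      obtain ⟨b, hb⟩ := hsim h hh
      exact commutatorElement_mem_symplecticGroup ha hb
    exact hle
  apply Set.Subset.antisymm
  · refine closure_minimal ?_ (isClosed_symplecticGroup.preimage Units.continuous_val)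
    exact hmem
  · intro g hg
    choose h hh hY using
      exists_sub_eq_natCast_pow_mul hℓ hmem (exists_mem_commutator_map_eq hℓ hsurj) hg
    exact mem_closure_of_tendsto (GL_tendsto_of_sub_eq_natCast_pow_mul hY)
      (Filter.Eventually.of_forall hh)
end

section
/- Let ℓ ≥ 5 be a prime and F a finite field of characteristic ℓ. Let H be a subgroup of GL₂(F) × GL₂(F) such that for every (b, b') ∈ H one has det(b) = det(b') and this common determinant lies in the prime subfield F_ℓ of F, and such that the projections of H onto each of the two factors GL₂(F) contain SL₂(F). Then either H contains SL₂(F) × SL₂(F), or there exist a matrix f ∈ GL₂(F), a group homomorphism χ : H → {±1} ⊆ F^×, and a field automorphism σ of F such that every (b, b') ∈ H satisfies b' = χ((b,b')) · σ(f b f⁻¹), where σ is applied to a matrix entrywise and χ((b,b')) acts as a scalar. -/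
open Matrix
open scoped MatrixGroups commutatorElement
open Matrix.SpecialLinearGroup (transvection toGL)

section NormalSubgroups

variable {F : Type*} [Field F]

/-- A normal subgroup of `SL₂(F)` is either central or everything, once `F` is large enough. -/
lemma Matrix.SpecialLinearGroup.normal_le_center_or_eq_top
    (hF : ∃ a : F, a ≠ 0 ∧ a ^ 2 ≠ 1) (N : Subgroup SL(2, F)) [hN : N.Normal] :
    N ≤ Subgroup.center SL(2, F) ∨ N = ⊤ := by
  have hsimple := Matrix.ProjectiveSpecialLinearGroup.rank_two_simple' hF
  obtain ⟨a, ha, hasq⟩ := hF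
  let π := QuotientGroup.mk' (Subgroup.center SL(2, F))
  have hπ : Function.Surjective π := QuotientGroup.mk'_surjective _
  rcases (hN.map π hπ).eq_bot_or_eq_top with h | h
  · left
    rwa [Subgroup.map_eq_bot_iff, QuotientGroup.ker_mk'] at h
  · right
    rw [eq_top_iff, ← SL2.commutator_eq_top ha hasq, commutator_def,
      Subgroup.commutator_le]
    -- every element is a central element times an element of `N`
    have key (g : SL(2, F)) : ∃ n ∈ N, ∃ z ∈ Subgroup.center SL(2, F), g = n * z := by
      obtain ⟨n, hn, hng⟩ : π g ∈ N.map π := h ▸ Subgroup.mem_top _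
      refine ⟨n, hn, n⁻¹ * g, ?_, by group⟩
      exact QuotientGroup.eq.1 hng
    intro g _ h _
    obtain ⟨n, hn, z, hz, rfl⟩ := key g
    obtain ⟨m, hm, w, hw, rfl⟩ := key h
    have hz' := Subgroup.mem_center_iff.1 hz
    have hw' := Subgroup.mem_center_iff.1 hw
    have : ⁅n * z, m * w⁆ = n * m * n⁻¹ * m⁻¹ := by
      have e1 : n * z * (m * w) = n * m * (w * z) := by
        rw [mul_assoc, ← mul_assoc z, ← hz' m]
        simp only [mul_assoc, hw' z]
      have e2 : m * w * (n * z) = m * n * (w * z) := by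
        rw [mul_assoc, ← mul_assoc w, ← hw' n]; simp only [mul_assoc]
      rw [commutatorElement_def, mul_assoc, ← _root_.mul_inv_rev, e1, e2]; group
    rw [this]
    exact mul_mem (mul_mem (mul_mem hn hm) (inv_mem hn)) (inv_mem hm)

lemma Matrix.SpecialLinearGroup.eq_one_or_eq_neg_one_of_mem_center {z : SL(2, F)}
    (hz : z ∈ Subgroup.center SL(2, F)) : z = 1 ∨ z = -1 := by
  obtain ⟨r, hr, h⟩ := Matrix.SpecialLinearGroup.mem_center_iff.1 hz
  have hr : r = 1 ∨ r = -1 := by simpa using hr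
  rcases hr with rfl | rfl
  · left; ext i j; simp [← h]
  · right; ext i j; fin_cases i <;> fin_cases j <;> simp [← h]

end NormalSubgroups

section Unipotent

variable {F : Type*} [Field F]

/-- The upper unitriangular matrix with upper right entry `x`. -/
def upperUni (x : F) : SL(2, F) := transvection zero_ne_one x

/-- The lower unitriangular matrix with lower left entry `x`. -/
def lowerUni (x : F) : SL(2, F) := transvection one_ne_zero x

@[simp] lemma upperUni_coe (x : F) : (upperUni x : Matrix (Fin 2) (Fin 2) F) = !![1, x; 0, 1] := by
  ext i j
  fin_cases i <;> fin_cases j <;>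
    simp [upperUni, Matrix.SpecialLinearGroup.transvection_coe]

@[simp] lemma lowerUni_coe (x : F) : (lowerUni x : Matrix (Fin 2) (Fin 2) F) = !![1, 0; x, 1] := by
  ext i j
  fin_cases i <;> fin_cases j <;>
    simp [lowerUni, Matrix.SpecialLinearGroup.transvection_coe]

lemma upperUni_add (x y : F) : upperUni (x + y) = upperUni x * upperUni y :=
  Matrix.SpecialLinearGroup.transvection_add _ x y

lemma lowerUni_add (x y : F) : lowerUni (x + y) = lowerUni x * lowerUni y :=
  Matrix.SpecialLinearGroup.transvection_add _ x y

lemma upperUni_pow (x : F) (n : ℕ) : upperUni x ^ n = upperUni (n * x) := by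
  induction n with
  | zero => simp [upperUni]
  | succ n ih => rw [pow_succ, ih, ← upperUni_add]; push_cast; ring_nf

lemma lowerUni_pow (x : F) (n : ℕ) : lowerUni x ^ n = lowerUni (n * x) := by
  induction n with
  | zero => simp [lowerUni]
  | succ n ih => rw [pow_succ, ih, ← lowerUni_add]; push_cast; ring_nf

lemma upperUni_zero : upperUni (0 : F) = 1 := by simp [upperUni]

lemma lowerUni_zero : lowerUni (0 : F) = 1 := by simp [lowerUni]

lemma upperUni_mem_center_iff {x : F} : upperUni x ∈ Subgroup.center SL(2, F) ↔ x = 0 :=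
  Matrix.SpecialLinearGroup.transvection_mem_center_iff _ _

/-- An element of order dividing `p` in characteristic `p` has trace `2`. -/
lemma trace_eq_two_of_pow_eq_one {p : ℕ} [Fact p.Prime] [CharP F p] {t : GL (Fin 2) F}
    (ht : t ^ p = 1) : (t : Matrix (Fin 2) (Fin 2) F).trace = 2 := by
  have h : ((t : Matrix (Fin 2) (Fin 2) F) - 1) ^ p = 0 := by
    rw [sub_pow_char_of_commute _ (Commute.one_right _), ← Units.val_pow_eq_pow_val, ht]
    simp
  have := (Matrix.isNilpotent_trace_of_isNilpotent ⟨p, h⟩).eq_zero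
  rw [Matrix.trace_sub, sub_eq_zero] at this
  simpa using this

/-- Two noncommuting unipotent matrices can be simultaneously put in triangular form, one upper
and the other lower. -/
lemma exists_conj_upperUni_lowerUni {m n : GL (Fin 2) F}
    (hm : (m : Matrix (Fin 2) (Fin 2) F).det = 1) (hn : (n : Matrix (Fin 2) (Fin 2) F).det = 1)
    (hm' : (m : Matrix (Fin 2) (Fin 2) F).trace = 2)
    (hn' : (n : Matrix (Fin 2) (Fin 2) F).trace = 2) (hmn : m * n ≠ n * m) :
    ∃ (f : GL (Fin 2) F) (r : F),
      f * toGL (upperUni 1) * f⁻¹ = m ∧ f * toGL (lowerUni r) * f⁻¹ = n := by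
  have conj_eq (f g k : GL (Fin 2) F) (h : f.val * g.val = k.val * f.val) :
      f * g * f⁻¹ = k := by
    rw [mul_inv_eq_iff_eq_mul]; exact Units.ext h
  obtain ⟨f, hf⟩ : ∃ f : GL (Fin 2) F, f * toGL (upperUni 1) * f⁻¹ = m := by
    rw [Matrix.det_fin_two] at hm
    rw [Matrix.trace_fin_two] at hm'
    by_cases hc : m.val 1 0 = 0
    · have ha : m.val 0 0 = 1 := by
        rw [← sub_eq_zero, ← sq_eq_zero_iff]
        linear_combination m.val 0 0 * hm' - hm - m.val 0 1 * hc
      have hd : m.val 1 1 = 1 := by linear_combination hm' - ha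
      have hb : m.val 0 1 ≠ 0 := by
        intro hb
        have : m = 1 := Units.ext (by
          rw [Matrix.eta_fin_two m.val, ha, hb, hc, hd, Units.val_one, Matrix.one_fin_two])
        simp [this] at hmn
      obtain ⟨f, hf⟩ : ∃ f : GL (Fin 2) F, f.val = !![m.val 0 1, 0; 0, 1] :=
        ⟨Matrix.GeneralLinearGroup.mkOfDetNeZero _ (by simpa), rfl⟩
      refine ⟨f, conj_eq _ _ _ ?_⟩
      rw [hf, Matrix.SpecialLinearGroup.coe_GL_coe_matrix, upperUni_coe, Matrix.eta_fin_two m.val]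
      simp [ha, hc, hd]
    · obtain ⟨f, hf⟩ : ∃ f : GL (Fin 2) F, f.val = !![m.val 0 0 - 1, 1; m.val 1 0, 0] :=
        ⟨Matrix.GeneralLinearGroup.mkOfDetNeZero _ (by simpa using hc), rfl⟩
      refine ⟨f, conj_eq _ _ _ ?_⟩
      rw [hf, Matrix.SpecialLinearGroup.coe_GL_coe_matrix, upperUni_coe, Matrix.eta_fin_two m.val]
      simp
      constructor
      · linear_combination hm - m.val 0 0 * hm'
      · linear_combination -m.val 1 0 * hm'
  obtain ⟨k, hk⟩ : ∃ k, f * k * f⁻¹ = n := ⟨f⁻¹ * n * f, by group⟩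
  subst hf hk
  have hk : k.val.det = 1 := by
    rwa [Units.val_mul, Units.val_mul, Matrix.det_units_conj] at hn
  have hk' : k.val.trace = 2 := by
    simpa [Matrix.trace_mul_cycle f.val] using hn'
  replace hmn : toGL (upperUni 1) * k ≠ k * toGL (upperUni 1) := by
    intro h
    apply hmn
    calc f * toGL (upperUni 1) * f⁻¹ * (f * k * f⁻¹) = f * (toGL (upperUni 1) * k) * f⁻¹ := by group
      _ = _ := by rw [h]; group
  rw [Matrix.det_fin_two] at hk
  rw [Matrix.trace_fin_two] at hk'
  have hr : k.val 1 0 ≠ 0 := by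
    intro hc
    have ha : k.val 0 0 = 1 := by
      rw [← sub_eq_zero, ← sq_eq_zero_iff]
      linear_combination k.val 0 0 * hk' - hk - k.val 0 1 * hc
    have hd : k.val 1 1 = 1 := by linear_combination hk' - ha
    apply hmn
    apply Units.ext
    rw [Units.val_mul, Units.val_mul, Matrix.SpecialLinearGroup.coe_GL_coe_matrix, upperUni_coe,
      Matrix.eta_fin_two k.val, ha, hc, hd]
    simp [add_comm]
  set e := (k.val 0 0 - 1) / k.val 1 0 with he
  have her : e * k.val 1 0 = k.val 0 0 - 1 := div_mul_cancel₀ _ hr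
  have hconj : toGL (upperUni e) * toGL (lowerUni (k.val 1 0)) * (toGL (upperUni e))⁻¹ = k := by
    apply conj_eq
    rw [Matrix.SpecialLinearGroup.coe_GL_coe_matrix, Matrix.SpecialLinearGroup.coe_GL_coe_matrix,
      upperUni_coe, lowerUni_coe, Matrix.eta_fin_two k.val]
    simp
    refine ⟨⟨by linear_combination her, ?_⟩, by linear_combination -her - hk'⟩
    apply mul_left_cancel₀ hr
    linear_combination (1 - k.val 0 0) * her + hk - k.val 0 0 * hk'
  refine ⟨f * toGL (upperUni e), k.val 1 0, ?_, ?_⟩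
  · have : upperUni e * upperUni 1 = upperUni 1 * upperUni e := by
      rw [← upperUni_add, add_comm, upperUni_add]
    rw [_root_.mul_inv_rev, mul_assoc f, ← map_mul, this, map_mul]
    group
  · rw [_root_.mul_inv_rev]
    nth_rw 2 [← hconj]
    group

/-- A matrix of trace `2` commuting with a nontrivial upper unitriangular matrix is
upper unitriangular. -/
lemma exists_eq_upperUni_of_commute {t : GL (Fin 2) F}
    (ht : (t : Matrix (Fin 2) (Fin 2) F).trace = 2) {r : F} (hr : r ≠ 0) (h2 : (2 : F) ≠ 0)
    (h : t * toGL (upperUni r) = toGL (upperUni r) * t) : ∃ a, t = toGL (upperUni a) := by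
  have h := congr_arg (Units.val) h
  rw [Units.val_mul, Units.val_mul, Matrix.SpecialLinearGroup.coe_GL_coe_matrix, upperUni_coe] at h
  have h00 := congr($h 0 0)
  have h01 := congr($h 0 1)
  rw [Matrix.trace_fin_two] at ht
  simp [Matrix.mul_apply, Fin.sum_univ_two, hr] at h00 h01
  have h11 : t.val 1 1 = t.val 0 0 := by
    apply mul_left_cancel₀ hr; linear_combination -h01
  have h00' : t.val 0 0 = 1 := by
    apply mul_left_cancel₀ h2; linear_combination ht - h11
  refine ⟨t.val 0 1, Units.ext ?_⟩
  rw [Matrix.SpecialLinearGroup.coe_GL_coe_matrix, upperUni_coe, Matrix.eta_fin_two t.val]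
  simp [h00, h11, h00']

lemma exists_eq_lowerUni_of_commute {t : GL (Fin 2) F}
    (ht : (t : Matrix (Fin 2) (Fin 2) F).trace = 2) {r : F} (hr : r ≠ 0) (h2 : (2 : F) ≠ 0)
    (h : t * toGL (lowerUni r) = toGL (lowerUni r) * t) : ∃ a, t = toGL (lowerUni a) := by
  have h := congr_arg (Units.val) h
  rw [Units.val_mul, Units.val_mul, Matrix.SpecialLinearGroup.coe_GL_coe_matrix, lowerUni_coe] at h
  have h00 := congr($h 0 0)
  have h01 := congr($h 1 0)
  rw [Matrix.trace_fin_two] at ht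
  simp [Matrix.mul_apply, Fin.sum_univ_two, hr] at h00 h01
  have h11 : t.val 1 1 = t.val 0 0 := by
    apply mul_left_cancel₀ hr; linear_combination h01
  have h00' : t.val 0 0 = 1 := by
    apply mul_left_cancel₀ h2; linear_combination ht - h11
  refine ⟨t.val 1 0, Units.ext ?_⟩
  rw [Matrix.SpecialLinearGroup.coe_GL_coe_matrix, lowerUni_coe, Matrix.eta_fin_two t.val]
  simp [h00, h11, h00']

lemma upperUni_lowerUni_commutator_notMem_center (h2 : (2 : F) ≠ 0) :
    upperUni (1 : F) * lowerUni 1 * (lowerUni 1 * upperUni 1)⁻¹ ∉ Subgroup.center SL(2, F) := by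
  intro h
  rcases Matrix.SpecialLinearGroup.eq_one_or_eq_neg_one_of_mem_center h with h | h
  · have := congr($(mul_inv_eq_one.1 h).val 0 0)
    simp [Matrix.mul_apply, Fin.sum_univ_two] at this
  · have := congr($(mul_inv_eq_iff_eq_mul.1 h).val 0 1)
    simp [Matrix.mul_apply, Fin.sum_univ_two] at this
    exact h2 (by linear_combination this)

end Unipotent

section Graph

variable {F : Type*} [Field F]

/-- A subgroup of `SL₂(F) × GL₂(F)` which is the graph of a function with values of
determinant `1`, up to signs and central elements. -/
structure IsProjectiveGraph (K : Subgroup (SL(2, F) × GL (Fin 2) F)) : Prop where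
  exists_right (s : SL(2, F)) : ∃ t, (s, t) ∈ K
  det_right {s : SL(2, F)} {t : GL (Fin 2) F} :
    (s, t) ∈ K → (t : Matrix (Fin 2) (Fin 2) F).det = 1
  right_of_one {t : GL (Fin 2) F} : (1, t) ∈ K → t = 1 ∨ t = -1
  left_of_one {s : SL(2, F)} : (s, 1) ∈ K → s ∈ Subgroup.center SL(2, F)

namespace IsProjectiveGraph

variable {K : Subgroup (SL(2, F) × GL (Fin 2) F)}

lemma eq_or_eq_neg (hK : IsProjectiveGraph K) {s : SL(2, F)} {t t' : GL (Fin 2) F}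
    (h : (s, t) ∈ K) (h' : (s, t') ∈ K) : t' = t ∨ t' = -t := by
  have : (1, t⁻¹ * t') ∈ K := by simpa using mul_mem (inv_mem h) h'
  rcases hK.right_of_one this with h | h
  · left; exact (inv_mul_eq_one.1 h).symm
  · right; rw [inv_mul_eq_iff_eq_mul.1 h]; simp

lemma conj (hK : IsProjectiveGraph K) (f : GL (Fin 2) F) :
    IsProjectiveGraph (K.comap ((MonoidHom.id _).prodMap (MulAut.conj f).toMonoidHom)) where
  exists_right s := by
    obtain ⟨t, ht⟩ := hK.exists_right s
    exact ⟨f⁻¹ * t * f, by simpa [Subgroup.mem_comap, mul_assoc] using ht⟩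
  det_right {s t} h := by
    have : (f * t * f⁻¹).val.det = 1 := hK.det_right (Subgroup.mem_comap.1 h)
    rwa [Units.val_mul, Units.val_mul, Matrix.det_units_conj] at this
  right_of_one {t} h := by
    have := hK.right_of_one (Subgroup.mem_comap.1 h)
    simpa [mul_inv_eq_iff_eq_mul, ← mul_neg_one f, -mul_neg, -mul_one] using this
  left_of_one h := hK.left_of_one (by simpa using Subgroup.mem_comap.1 h)

variable {p : ℕ}

lemma exists_pow_eq_one (hK : IsProjectiveGraph K) (hp : Odd p) {s : SL(2, F)} (hs : s ^ p = 1) :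
    ∃ t, (s, t) ∈ K ∧ t ^ p = 1 := by
  obtain ⟨t, ht⟩ := hK.exists_right s
  have h1 : (1, t ^ p) ∈ K := by simpa [hs] using pow_mem ht p
  rcases hK.right_of_one h1 with h | h
  · exact ⟨t, ht, h⟩
  · refine ⟨-t, ?_, by rw [hp.neg_pow, h, neg_neg]⟩
    rw [h] at h1
    simpa using mul_mem h1 ht

lemma eq_of_pow_eq_one (hK : IsProjectiveGraph K) (hp : Odd p) (h2 : (2 : F) ≠ 0)
    {s : SL(2, F)} {t t' : GL (Fin 2) F}
    (h : (s, t) ∈ K) (h' : (s, t') ∈ K) (ht : t ^ p = 1) (ht' : t' ^ p = 1) : t = t' := by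
  rcases hK.eq_or_eq_neg h h' with e | e
  · exact e.symm
  · rw [e, hp.neg_pow, ht] at ht'
    have := congr(($ht').val 0 0)
    simp at this
    exact absurd (by linear_combination -this) h2

lemma commute_of_pow_eq_one (hK : IsProjectiveGraph K) (hp : Odd p) (h2 : (2 : F) ≠ 0)
    {s s' : SL(2, F)} {t t' : GL (Fin 2) F} (hss : s * s' = s' * s)
    (h : (s, t) ∈ K) (h' : (s', t') ∈ K) (ht : t ^ p = 1) : t * t' = t' * t := by
  have h1 : (s, t' * t * t'⁻¹) ∈ K := by
    have := mul_mem (mul_mem h' h) (inv_mem h')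
    simpa [← hss] using this
  have := hK.eq_of_pow_eq_one hp h2 h h1 ht (by rw [conj_pow, ht]; simp)
  rw [eq_mul_inv_iff_mul_eq] at this
  exact this

/-- If the unitriangular matrices correspond to unitriangular matrices, the correspondence is
given by a field automorphism. -/
lemma exists_ringEquiv [Finite F] (hK : IsProjectiveGraph K) (h2 : (2 : F) ≠ 0)
    (hU : ∀ x, ∃ a, (upperUni x, toGL (upperUni a)) ∈ K)
    (hL : ∀ x, ∃ a, (lowerUni x, toGL (lowerUni a)) ∈ K)
    (h1 : (upperUni 1, toGL (upperUni 1)) ∈ K) :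
    ∃ σ : F ≃+* F, ∀ s, (s, toGL (Matrix.SpecialLinearGroup.map σ.toRingHom s)) ∈ K := by
  choose α hα using hU
  choose β hβ using hL
  have hone : (1 : F) ≠ -1 := fun h ↦ h2 (by linear_combination h)
  have uniq {s : SL(2, F)} {a b : F} (ha : (s, toGL (upperUni a)) ∈ K)
      (hb : (s, toGL (upperUni b)) ∈ K) : a = b := by
    rcases hK.eq_or_eq_neg ha hb with e | e
    · simpa using congr($(e).val 0 1).symm
    · exact absurd (by simpa using congr($(e).val 0 0)) hone
  have hα1 : α 1 = 1 := uniq (hα 1) h1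
  have hadd x y : α (x + y) = α x + α y := uniq (hα _) (by
    rw [upperUni_add, upperUni_add, map_mul]
    exact mul_mem (hα x) (hα y))
  have hα0 : α 0 = 0 := by simpa using hadd 0 0
  have hneg x : α (-x) = - α x := by
    rw [eq_neg_iff_add_eq_zero, ← hadd]; simp [hα0]
  have hinj x (hx : α x = 0) : x = 0 := by
    have := hα x
    rw [hx, upperUni_zero, map_one] at this
    exact upperUni_mem_center_iff.1 (hK.left_of_one this)
  -- the Weyl elements conjugate upper unitriangular matrices to lower ones
  have weyl (t x : F) (ht : t ≠ 0) (hx : x ≠ 0) :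
      α t * β (-t⁻¹) = -1 ∧ α t ^ 2 * β (-x / t ^ 2) = - α x := by
    set a := α t with ha
    set b := β (-t⁻¹)
    set e := α x
    set g := β (-x / t ^ 2)
    have he : e ≠ 0 := fun h ↦ hx (hinj x h)
    have hW : (upperUni t * lowerUni (-t⁻¹) * upperUni t,
        toGL (upperUni a) * toGL (lowerUni b) * toGL (upperUni a)) ∈ K :=
      mul_mem (mul_mem (hα t) (hβ _)) (hα t)
    have hl := mul_mem hW (hα x)
    have hr := mul_mem (hβ (-x / t ^ 2)) hW
    have hs : upperUni t * lowerUni (-t⁻¹) * upperUni t * upperUni x =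
        lowerUni (-x / t ^ 2) * (upperUni t * lowerUni (-t⁻¹) * upperUni t) := by
      ext i j
      fin_cases i <;> fin_cases j <;> simp [Matrix.mul_apply, Fin.sum_univ_two, ht]
      field_simp
    rw [Prod.mk_mul_mk] at hl hr
    rw [hs] at hl
    have key : ∃ ε : F, (ε = 1 ∨ ε = -1) ∧ ∀ i j,
        (toGL (upperUni a) * toGL (lowerUni b) * toGL (upperUni a) * toGL (upperUni e)).val i j =
        ε * (toGL (lowerUni g) *
          (toGL (upperUni a) * toGL (lowerUni b) * toGL (upperUni a))).val i j := by
      rcases hK.eq_or_eq_neg hr hl with h | h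
      · exact ⟨1, .inl rfl, fun i j ↦ by rw [h, one_mul]⟩
      · exact ⟨-1, .inr rfl, fun i j ↦ by
          rw [h, Units.val_neg, Matrix.neg_apply, neg_one_mul]⟩
    obtain ⟨ε, hε, key⟩ := key
    have k00 := key 0 0
    have k01 := key 0 1
    have k10 := key 1 0
    have k11 := key 1 1
    simp [Matrix.mul_apply, Fin.sum_univ_two] at k00 k01 k10 k11
    rcases hε with rfl | rfl
    · have hab : a * b = -1 := by
        apply mul_left_cancel₀ he
        linear_combination k01
      exact ⟨hab, by linear_combination -a * k11 + (e - a ^ 2 * g) * hab⟩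
    · exfalso
      have hab : a * b = -1 := by
        apply mul_left_cancel₀ h2
        linear_combination k00
      have hb : b = 0 := by
        apply mul_left_cancel₀ h2
        linear_combination k10 - g * hab
      simp [hb] at hab
  have hβ0 : β 0 = 0 := by
    have := hβ 0
    rw [lowerUni_zero] at this
    rcases hK.right_of_one this with e | e
    · simpa using congr($(e).val 1 0)
    · exact absurd (by simpa using congr($(e).val 0 0)) hone
  have hβα x : β x = α x := by
    by_cases hx : x = 0
    · rw [hx, hβ0, hα0]
    · have := (weyl 1 (-x) one_ne_zero (neg_ne_zero.2 hx)).2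
      simpa [hα1, hneg] using this
  have hinv t (ht : t ≠ 0) : α t * α t⁻¹ = 1 := by
    have := (weyl t 1 ht one_ne_zero).1
    rw [hβα, hneg] at this
    linear_combination -this
  have hsq t : α (t ^ 2) = α t ^ 2 := by
    by_cases ht : t = 0
    · simp [ht, hα0]
    · have h := (weyl t 1 ht one_ne_zero).2
      have h' := hinv (t ^ 2) (pow_ne_zero 2 ht)
      rw [hβα, neg_div, hneg, one_div, hα1] at h
      have h0 : α (t ^ 2)⁻¹ ≠ 0 := right_ne_zero_of_mul (h'.trans_ne one_ne_zero)
      apply mul_right_cancel₀ h0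
      linear_combination h' + h
  have hmul x y : α (x * y) = α x * α y := by
    have h := hsq (x + y)
    rw [show (x + y) ^ 2 = x ^ 2 + (x * y + x * y) + y ^ 2 by ring, hadd, hadd, hadd, hadd,
      hsq, hsq] at h
    apply mul_left_cancel₀ h2
    linear_combination h
  let φ : F →+* F := ⟨⟨⟨α, hα1⟩, hmul⟩, hα0, hadd⟩
  refine ⟨RingEquiv.ofBijective φ (Finite.injective_iff_bijective.1 φ.injective), fun s ↦ ?_⟩
  change (s, toGL (Matrix.SpecialLinearGroup.map φ s)) ∈ K
  induction s using SL2.transvection_induction with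
  | hmul A B hA hB => rw [map_mul, map_mul]; exact mul_mem hA hB
  | htransvec i j h c =>
    have hφU : Matrix.SpecialLinearGroup.map φ (upperUni c) = upperUni (α c) := by
      ext i j; fin_cases i <;> fin_cases j <;> simp [φ, hα0, hα1]
    have hφL : Matrix.SpecialLinearGroup.map φ (lowerUni c) = lowerUni (β c) := by
      ext i j; fin_cases i <;> fin_cases j <;> simp [φ, hα0, hα1, hβα]
    fin_cases i <;> fin_cases j
    · simp at h
    · change (upperUni c, toGL (Matrix.SpecialLinearGroup.map φ (upperUni c))) ∈ K
      rw [hφU]; exact hα c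
    · change (lowerUni c, toGL (Matrix.SpecialLinearGroup.map φ (lowerUni c))) ∈ K
      rw [hφL]; exact hβ c
    · simp at h

variable [Fact p.Prime] [CharP F p]

/-- A subgroup that is a graph up to signs contains the graph of an isomorphism which is the
composite of a field automorphism and a conjugation. -/
theorem exists_conj_ringEquiv [Finite F] (hK : IsProjectiveGraph K) (hp : Odd p) :
    ∃ (f : GL (Fin 2) F) (σ : F ≃+* F), ∀ s,
      (s, f * toGL (Matrix.SpecialLinearGroup.map σ.toRingHom s) * f⁻¹) ∈ K := by
  have h2 : (2 : F) ≠ 0 := by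
    apply Ring.two_ne_zero
    rw [ringChar.eq F p]
    rintro rfl
    exact absurd hp (by decide)
  have hUp (x : F) : upperUni x ^ p = 1 := by
    rw [upperUni_pow, CharP.cast_eq_zero, zero_mul, upperUni_zero]
  have hLp (x : F) : lowerUni x ^ p = 1 := by
    rw [lowerUni_pow, CharP.cast_eq_zero, zero_mul, lowerUni_zero]
  obtain ⟨m, hm, hmp⟩ := hK.exists_pow_eq_one hp (hUp 1)
  obtain ⟨n, hn, hnp⟩ := hK.exists_pow_eq_one hp (hLp 1)
  have hmn : m * n ≠ n * m := by
    intro h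
    have h1 : (upperUni 1 * lowerUni 1 * (lowerUni 1 * upperUni 1)⁻¹, m * n * (n * m)⁻¹) ∈ K :=
      mul_mem (mul_mem hm hn) (inv_mem (mul_mem hn hm))
    rw [h, mul_inv_cancel] at h1
    exact upperUni_lowerUni_commutator_notMem_center h2 (hK.left_of_one h1)
  obtain ⟨f, r, rfl, rfl⟩ := exists_conj_upperUni_lowerUni (hK.det_right hm) (hK.det_right hn)
    (trace_eq_two_of_pow_eq_one hmp) (trace_eq_two_of_pow_eq_one hnp) hmn
  have hr : r ≠ 0 := by
    rintro rfl
    simp [lowerUni_zero] at hmn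
  have hK' := hK.conj f
  set K' := K.comap ((MonoidHom.id _).prodMap (MulAut.conj f).toMonoidHom) with hK'_def
  have hm' : (upperUni 1, toGL (upperUni 1)) ∈ K' := hm
  have hn' : (lowerUni 1, toGL (lowerUni r)) ∈ K' := hn
  have hU x : ∃ a, (upperUni x, toGL (upperUni a)) ∈ K' := by
    obtain ⟨t, ht, htp⟩ := hK'.exists_pow_eq_one hp (hUp x)
    obtain ⟨a, rfl⟩ := exists_eq_upperUni_of_commute (trace_eq_two_of_pow_eq_one htp) one_ne_zero h2
      (hK'.commute_of_pow_eq_one hp h2 (by rw [← upperUni_add, add_comm, upperUni_add]) ht hm' htp)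
    exact ⟨a, ht⟩
  have hL x : ∃ a, (lowerUni x, toGL (lowerUni a)) ∈ K' := by
    obtain ⟨t, ht, htp⟩ := hK'.exists_pow_eq_one hp (hLp x)
    obtain ⟨a, rfl⟩ := exists_eq_lowerUni_of_commute (trace_eq_two_of_pow_eq_one htp) hr h2
      (hK'.commute_of_pow_eq_one hp h2 (by rw [← lowerUni_add, add_comm, lowerUni_add]) ht hn' htp)
    exact ⟨a, ht⟩
  obtain ⟨σ, hσ⟩ := hK'.exists_ringEquiv h2 hU hL hm'
  exact ⟨f, σ, hσ⟩

end IsProjectiveGraph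

end Graph

section Main

variable {F : Type*} [Field F]

lemma exists_toGL_eq {b : GL (Fin 2) F} (hb : (b : Matrix (Fin 2) (Fin 2) F).det = 1) :
    ∃ s : SL(2, F), toGL s = b :=
  ⟨⟨b, hb⟩, Units.ext rfl⟩

lemma commute_of_conj_eq_or_eq_neg {k t : GL (Fin 2) F} (h2 : (2 : F) ≠ 0)
    (ht : (t : Matrix (Fin 2) (Fin 2) F).trace ≠ 0)
    (h : k * t * k⁻¹ = t ∨ k * t * k⁻¹ = -t) : k * t = t * k := by
  rcases h with h | h
  · exact mul_inv_eq_iff_eq_mul.1 h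
  · have h := congr(($h).val.trace)
    rw [Units.val_mul, Units.val_mul, Matrix.trace_mul_cycle, Units.inv_mul, one_mul,
      Units.val_neg, Matrix.trace_neg] at h
    exact absurd (mul_left_cancel₀ h2 (by linear_combination h)) ht

/-- The elementary unitriangular matrices have centralizer `{±1}` in `SL₂(F)`. -/
lemma eq_one_or_eq_neg_one_of_commute {k : GL (Fin 2) F}
    (hk : (k : Matrix (Fin 2) (Fin 2) F).det = 1)
    (hU : k * toGL (upperUni 1) = toGL (upperUni 1) * k)
    (hL : k * toGL (lowerUni 1) = toGL (lowerUni 1) * k) : k = 1 ∨ k = -1 := by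
  have hU := congr_arg Units.val hU
  have hL := congr_arg Units.val hL
  rw [Units.val_mul, Units.val_mul, Matrix.SpecialLinearGroup.coe_GL_coe_matrix] at hU hL
  rw [upperUni_coe] at hU
  rw [lowerUni_coe] at hL
  have h00 := congr($hU 0 0)
  have h01 := congr($hU 0 1)
  have h00' := congr($hL 0 0)
  simp [Matrix.mul_apply, Fin.sum_univ_two] at h00 h01 h00'
  have h11 : k.val 1 1 = k.val 0 0 := by linear_combination -h01
  rw [Matrix.det_fin_two, h11, h00, h00', mul_zero, sub_zero] at hk
  rcases mul_self_eq_one_iff.1 hk with h | h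
  · left
    ext i j
    fin_cases i <;> fin_cases j <;> simp [h00, h00', h11, h]
  · right
    ext i j
    fin_cases i <;> fin_cases j <;> simp [h00, h00', h11, h]

end Main

theorem stmt3 (ℓ : ℕ) (hprime : Nat.Prime ℓ) (hℓ : 5 ≤ ℓ)
    (F : Type*) [Field F] [Fintype F] [CharP F ℓ]
    (H : Subgroup (GL (Fin 2) F × GL (Fin 2) F))
    (hdet : ∀ p ∈ H, ∃ m : ℤ,
      (↑p.1 : Matrix (Fin 2) (Fin 2) F).det = (m : F) ∧
      (↑p.2 : Matrix (Fin 2) (Fin 2) F).det = (m : F))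
    (hproj1 : ∀ b : GL (Fin 2) F, (↑b : Matrix (Fin 2) (Fin 2) F).det = 1 →
      ∃ b' : GL (Fin 2) F, (b, b') ∈ H)
    (hproj2 : ∀ b' : GL (Fin 2) F, (↑b' : Matrix (Fin 2) (Fin 2) F).det = 1 →
      ∃ b : GL (Fin 2) F, (b, b') ∈ H) :
    (∀ b b' : GL (Fin 2) F, (↑b : Matrix (Fin 2) (Fin 2) F).det = 1 →
        (↑b' : Matrix (Fin 2) (Fin 2) F).det = 1 → (b, b') ∈ H)
    ∨ (∃ f : GL (Fin 2) F, ∃ χ : H →* Fˣ, ∃ σ : F ≃+* F,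
        (∀ h : H, (χ h : F) = 1 ∨ (χ h : F) = -1) ∧
        ∀ p : H, (↑(p : (GL (Fin 2) F × GL (Fin 2) F)).2 : Matrix (Fin 2) (Fin 2) F)
          = (χ p : F) •
            ((↑(f * (p : (GL (Fin 2) F × GL (Fin 2) F)).1 * f⁻¹) : Matrix (Fin 2) (Fin 2) F).map σ)) := by
  have : Fact ℓ.Prime := ⟨hprime⟩
  have hodd : Odd ℓ := hprime.odd_of_ne_two (by omega)
  have h2 : (2 : F) ≠ 0 := by
    apply Ring.two_ne_zero
    rw [ringChar.eq F ℓ]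
    omega
  have h3 : (3 : F) ≠ 0 := by
    intro h
    have := (CharP.cast_eq_zero_iff F ℓ 3).1 (by exact_mod_cast h)
    have := Nat.le_of_dvd (by norm_num) this
    omega
  have hF : ∃ a : F, a ≠ 0 ∧ a ^ 2 ≠ 1 := ⟨2, h2, fun h ↦ h3 (by linear_combination h)⟩
  have hdet' {b b' : GL (Fin 2) F} (h : (b, b') ∈ H) : b.val.det = b'.val.det := by
    obtain ⟨m, h, h'⟩ := hdet _ h
    exact h.trans h'.symm
  let N₁ : Subgroup SL(2, F) := H.comap ((MonoidHom.inl _ _).comp toGL)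
  let N₂ : Subgroup SL(2, F) := H.comap ((MonoidHom.inr _ _).comp toGL)
  have hN₁ : N₁.Normal := ⟨fun n hn g ↦ by
    obtain ⟨b', hb'⟩ := hproj1 (toGL g) g.2
    have : (toGL n, 1) ∈ H := hn
    have := mul_mem (mul_mem hb' this) (inv_mem hb')
    change (toGL (g * n * g⁻¹), 1) ∈ H
    simpa using this⟩
  have hN₂ : N₂.Normal := ⟨fun n hn g ↦ by
    obtain ⟨b, hb⟩ := hproj2 (toGL g) g.2
    have : (1, toGL n) ∈ H := hn
    have := mul_mem (mul_mem hb this) (inv_mem hb)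
    change (1, toGL (g * n * g⁻¹)) ∈ H
    simpa using this⟩
  rcases Matrix.SpecialLinearGroup.normal_le_center_or_eq_top hF N₁ with h₁ | h₁
  swap
  · left
    intro b b' hb hb'
    obtain ⟨c, hc⟩ := hproj2 b' hb'
    obtain ⟨s, hs⟩ := exists_toGL_eq (b := b * c⁻¹) (by
      rw [Units.val_mul, Matrix.det_mul, Matrix.coe_units_inv, Matrix.det_nonsing_inv,
        hdet' hc, hb, hb']; simp)
    have hs₁ : s ∈ N₁ := h₁ ▸ Subgroup.mem_top s
    have : (toGL s, 1) ∈ H := hs₁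
    simpa [hs] using mul_mem this hc
  rcases Matrix.SpecialLinearGroup.normal_le_center_or_eq_top hF N₂ with h₂ | h₂
  swap
  · left
    intro b b' hb hb'
    obtain ⟨c, hc⟩ := hproj1 b hb
    obtain ⟨s, hs⟩ := exists_toGL_eq (b := b' * c⁻¹) (by
      rw [Units.val_mul, Matrix.det_mul, Matrix.coe_units_inv, Matrix.det_nonsing_inv,
        ← hdet' hc, hb, hb']; simp)
    have hs₂ : s ∈ N₂ := h₂ ▸ Subgroup.mem_top s
    have : (1, toGL s) ∈ H := hs₂
    simpa [hs] using mul_mem this hc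
  right
  have hK : IsProjectiveGraph (H.comap (toGL.prodMap (MonoidHom.id (GL (Fin 2) F)))) :=
    { exists_right s := hproj1 (toGL s) s.2
      det_right {s t} h := by
        have h : (toGL s, t) ∈ H := h
        rw [← hdet' h]
        exact s.2
      right_of_one {t} h := by
        have h : (toGL (1 : SL(2, F)), t) ∈ H := h
        obtain ⟨s, rfl⟩ := exists_toGL_eq (b := t) (by rw [← hdet' h]; simp)
        rw [map_one] at h
        rcases Matrix.SpecialLinearGroup.eq_one_or_eq_neg_one_of_mem_center (h₂ h) with e | e
        · exact .inl (by rw [e, map_one])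
        · exact .inr (by rw [e]; ext i j; simp)
      left_of_one h := h₁ h }
  obtain ⟨f, σ, hσ⟩ := hK.exists_conj_ringEquiv hodd
  obtain ⟨g, hg⟩ : ∃ g : GL (Fin 2) F →* GL (Fin 2) F,
      ∀ b, g b = f * Matrix.GeneralLinearGroup.map σ.toRingHom b * f⁻¹ :=
    ⟨(MulAut.conj f).toMonoidHom.comp (Matrix.GeneralLinearGroup.map σ.toRingHom), fun _ ↦ rfl⟩
  have hmap (s : SL(2, F)) : Matrix.GeneralLinearGroup.map σ.toRingHom (toGL s) =
      toGL (Matrix.SpecialLinearGroup.map σ.toRingHom s) := by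
    ext i j
    simp
  have hgdet (b : GL (Fin 2) F) : (g b).val.det = σ b.val.det := by
    rw [hg, Units.val_mul, Units.val_mul, Matrix.det_units_conj, RingEquiv.map_det]
    rfl
  have hgH (s : SL(2, F)) : (toGL s, g (toGL s)) ∈ H := by
    rw [hg, hmap]
    exact hσ s
  -- every element of `H` is on the graph of `g`, up to sign
  have main (p : H) : ∃ c : Fˣ, (c.val = 1 ∨ c.val = -1) ∧
      p.1.2 = Matrix.GeneralLinearGroup.scalar (Fin 2) c * g p.1.1 := by
    obtain ⟨⟨b, b'⟩, hp⟩ := p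
    obtain ⟨k, hb'⟩ : ∃ k, b' = g b * (f * k * f⁻¹) := ⟨f⁻¹ * ((g b)⁻¹ * b') * f, by group⟩
    have hkdet : k.val.det = 1 := by
      obtain ⟨m, h, h'⟩ := hdet _ hp
      have h1 : (g b).val.det = b'.val.det := by
        rw [hgdet]; simp only at h h'; rw [h, h', map_intCast]
      rw [hb', Units.val_mul, Matrix.det_mul, Units.val_mul, Units.val_mul,
        Matrix.det_units_conj] at h1
      exact (mul_eq_left₀ (Matrix.GeneralLinearGroup.det_ne_zero (g b))).1 h1.symm
    have comm (s : SL(2, F)) (hs : Matrix.SpecialLinearGroup.map σ.toRingHom s = s)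
        (hs' : s.val.trace ≠ 0) : k * toGL s = toGL s * k := by
      apply commute_of_conj_eq_or_eq_neg h2 hs'
      obtain ⟨s', hs'⟩ := exists_toGL_eq (b := b * toGL s * b⁻¹) (by
        rw [Units.val_mul, Units.val_mul, Matrix.det_units_conj]; exact s.2)
      have ha : (toGL s', b' * g (toGL s) * b'⁻¹) ∈ H := by
        rw [hs']; exact mul_mem (mul_mem hp (hgH s)) (inv_mem hp)
      have e : b' * g (toGL s) * b'⁻¹ = g (toGL s') ∨ b' * g (toGL s) * b'⁻¹ = -g (toGL s') :=
        hK.eq_or_eq_neg (hgH s') ha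
      have hgs : g (toGL s) = f * toGL s * f⁻¹ := by
        rw [hg, hmap, hs]
      have hgs' : g (toGL s') = g b * (f * toGL s * f⁻¹) * (g b)⁻¹ := by
        rw [hs', map_mul, map_mul, map_inv, hgs]
      have hk : k * toGL s * k⁻¹ = f⁻¹ * ((g b)⁻¹ * (b' * g (toGL s) * b'⁻¹) * g b) * f := by
        rw [hb', hgs]; group
      rw [hgs'] at e
      rcases e with e | e
      · left
        rw [hk, e]; group
      · right
        rw [hk, e]
        simp only [mul_neg, neg_mul]
        group
    have hU := comm (upperUni 1) (by ext i j; fin_cases i <;> fin_cases j <;> simp)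
      (by simpa [Matrix.trace_fin_two, one_add_one_eq_two])
    have hL := comm (lowerUni 1) (by ext i j; fin_cases i <;> fin_cases j <;> simp)
      (by simpa [Matrix.trace_fin_two, one_add_one_eq_two])
    rcases eq_one_or_eq_neg_one_of_commute hkdet hU hL with h | h
    · refine ⟨1, .inl rfl, ?_⟩
      rw [h] at hb'
      simpa using hb'
    · refine ⟨-1, .inr rfl, ?_⟩
      rw [h] at hb'
      have : Matrix.GeneralLinearGroup.scalar (Fin 2) (-1 : Fˣ) = -1 := by
        ext i j; fin_cases i <;> fin_cases j <;> simp
      simpa [this] using hb'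
  choose χ hχ hχ' using main
  refine ⟨Matrix.GeneralLinearGroup.map σ.symm.toRingHom f, MonoidHom.mk' χ ?_, σ, hχ, ?_⟩
  · intro p q
    have h := hχ' (p * q)
    have h' : (p * q).1.2 = p.1.2 * q.1.2 := rfl
    have h'' : (p * q).1.1 = p.1.1 * q.1.1 := rfl
    rw [h', h'', hχ' p, hχ' q, map_mul, mul_assoc, ← mul_assoc (g p.1.1),
      ← Matrix.GeneralLinearGroup.scalar_commute, mul_assoc, ← mul_assoc, ← map_mul,
      mul_right_cancel_iff] at h
    ext
    simpa using congr($(h).val 0 0).symm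
  · intro p
    have h : Matrix.GeneralLinearGroup.map σ.toRingHom
        (Matrix.GeneralLinearGroup.map σ.symm.toRingHom f * p.1.1 *
          (Matrix.GeneralLinearGroup.map σ.symm.toRingHom f)⁻¹) = g p.1.1 := by
      have : Matrix.GeneralLinearGroup.map σ.toRingHom
          (Matrix.GeneralLinearGroup.map σ.symm.toRingHom f) = f := by
        ext i j; simp
      rw [map_mul, map_mul, map_inv, this, hg]
    rw [hχ' p, ← h]
    ext i j
    rw [Units.val_mul, Matrix.GeneralLinearGroup.coe_scalar, Matrix.scalar_apply,
      Matrix.diagonal_mul]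
    rfl
end

section
/- Let ℓ ≥ 5 be a prime and let F₁, F₂ be finite fields of characteristic ℓ. Suppose G is a subgroup of SL₂(F₁) × SL₂(F₂) whose projection onto each of the two factors is surjective. If G is a proper subgroup of SL₂(F₁) × SL₂(F₂), then F₁ and F₂ have the same cardinality. -/
open Matrix

open scoped MatrixGroups

/-- The order of `SL₂` over a finite field with `q` elements is `(q² - 1) q`. -/
theorem card_SL_two (F : Type*) [Field F] [Fintype F] :
    Nat.card SL(2, F) = (Fintype.card F ^ 2 - 1) * Fintype.card F := by
  have hq : 1 < Fintype.card F := Fintype.one_lt_card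
  have hGL := Matrix.card_GL_field (𝔽 := F) 2
  rw [Fin.prod_univ_two] at hGL
  have hker := Subgroup.card_mul_index (GeneralLinearGroup.det (n := Fin 2) (R := F)).ker
  rw [Subgroup.index_ker, MonoidHom.range_eq_top.2 GeneralLinearGroup.det_surjective,
    Subgroup.card_top, Nat.card_units, Nat.card_eq_fintype_card (α := F), hGL] at hker
  have hSL : Nat.card SL(2, F) = Nat.card (GeneralLinearGroup.det (n := Fin 2) (R := F)).ker := by
    refine Nat.card_congr (Equiv.ofBijective
      (fun A => ⟨(A : GL (Fin 2) F), ?_⟩) ⟨fun A B h => ?_, fun ⟨A, hA⟩ => ?_⟩)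
    · rw [MonoidHom.mem_ker]
      ext
      simp
    · exact SpecialLinearGroup.toGL_injective (Subtype.ext_iff.1 h)
    · refine ⟨⟨A, ?_⟩, Subtype.ext (Units.ext rfl)⟩
      simpa using congrArg Units.val (MonoidHom.mem_ker.1 hA)
  rw [hSL]
  refine Nat.eq_of_mul_eq_mul_right (Nat.sub_pos_of_lt hq) (hker.trans ?_)
  obtain ⟨k, hk⟩ := Nat.exists_eq_add_of_lt hq
  rw [hk]
  have h : (1 + k + 1) ^ 2 - (1 + k + 1) = (1 + k + 1) * (1 + k + 1 - 1) := by
    rw [Nat.mul_sub, mul_one, sq]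
  simp only [Fin.val_zero, Fin.val_one, pow_zero, pow_one, h]
  ring

theorem card_center_SL_two_le (F : Type*) [Field F] :
    Nat.card (Subgroup.center SL(2, F)) ≤ 2 := by
  rw [Nat.card_congr (SpecialLinearGroup.center_equiv_rootsOfUnity' (0 : Fin 2)).toEquiv]
  exact card_rootsOfUnity F 2

/-- A proper normal subgroup of `SL₂` over a field with at least four elements is central. -/
theorem SL_two_normal_le_center {F : Type*} [Field F] [Fintype F] (hF : 4 ≤ Fintype.card F)
    (N : Subgroup SL(2, F)) [N.Normal] (hN : N ≠ ⊤) : N ≤ Subgroup.center SL(2, F) := by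
  have hsimple : IsSimpleGroup PSL(2, F) :=
    Matrix.ProjectiveSpecialLinearGroup.rank_two_simple (by rwa [Nat.card_eq_fintype_card])
  have hmap : (N.map (QuotientGroup.mk' (Subgroup.center SL(2, F)))).Normal :=
    Subgroup.Normal.map inferInstance _ (QuotientGroup.mk'_surjective _)
  rcases hmap.eq_bot_or_eq_top with h | h
  · rwa [Subgroup.map_eq_bot_iff, QuotientGroup.ker_mk'] at h
  · have hsup : N ⊔ Subgroup.center SL(2, F) = ⊤ := by
      rw [← QuotientGroup.ker_mk' (Subgroup.center SL(2, F)), ← Subgroup.comap_map_eq, h,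
        Subgroup.comap_top]
    have hcomm : commutator SL(2, F) ≤ N :=
      Subgroup.Normal.commutator_le_of_self_sup_commutative_eq_top hsup inferInstance
    classical
    obtain ⟨a, ha⟩ : ∃ a : F, a ∉ ({0, 1, -1} : Finset F) := by
      by_contra! h
      have := (Finset.card_le_card fun a (_ : a ∈ Finset.univ) => h a).trans Finset.card_le_three
      rw [Finset.card_univ] at this
      omega
    simp only [Finset.mem_insert, Finset.mem_singleton, not_or] at ha
    rw [SL2.commutator_eq_top ha.1 (by rw [Ne, sq_eq_one_iff]; tauto)] at hcomm
    exact absurd (top_le_iff.1 hcomm) hN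

/-- The quotient of `SL₂` by a proper normal subgroup has at least half the order of `SL₂`. -/
theorem card_SL_two_le_two_mul_card_quotient {F : Type*} [Field F] [Fintype F]
    (hF : 4 ≤ Fintype.card F) (N : Subgroup SL(2, F)) [N.Normal] (hN : N ≠ ⊤) :
    Nat.card SL(2, F) ≤ 2 * Nat.card (SL(2, F) ⧸ N) := by
  rw [Subgroup.card_eq_card_quotient_mul_card_subgroup N, mul_comm]
  exact Nat.mul_le_mul_right _ ((Subgroup.card_le_of_le (SL_two_normal_le_center hF N hN)).trans
    (card_center_SL_two_le F))

/-- Distinct cardinalities of finite fields of the same characteristic differ at least by a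
factor of two. -/
theorem FiniteField.two_mul_card_le_card {F₁ F₂ : Type*} [Field F₁] [Fintype F₁] [Field F₂]
    [Fintype F₂] (p : ℕ) [CharP F₁ p] [CharP F₂ p] (h : Fintype.card F₁ < Fintype.card F₂) :
    2 * Fintype.card F₁ ≤ Fintype.card F₂ := by
  obtain ⟨m, hp, hm⟩ := FiniteField.card F₁ p
  obtain ⟨n, -, hn⟩ := FiniteField.card F₂ p
  rw [hm, hn] at h ⊢
  have hmn := (Nat.pow_lt_pow_iff_right hp.one_lt).1 h
  calc 2 * p ^ (m : ℕ) ≤ p * p ^ (m : ℕ) := Nat.mul_le_mul_right _ hp.two_le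
    _ = p ^ ((m : ℕ) + 1) := (pow_succ' _ _).symm
    _ ≤ p ^ (n : ℕ) := Nat.pow_le_pow_right hp.pos hmn

/-- If `SL₂(F₂)` has at most twice as many elements as `SL₂(F₁)`, where `F₁` and `F₂` are finite
fields of the same characteristic, then `F₂` is not larger than `F₁`. -/
theorem card_le_of_card_SL_two_le {F₁ F₂ : Type*} [Field F₁] [Fintype F₁] [Field F₂]
    [Fintype F₂] (p : ℕ) [CharP F₁ p] [CharP F₂ p]
    (h : Nat.card SL(2, F₂) ≤ 2 * Nat.card SL(2, F₁)) :
    Fintype.card F₂ ≤ Fintype.card F₁ := by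
  by_contra! hlt
  have hle := FiniteField.two_mul_card_le_card p hlt
  have hq : 1 < Fintype.card F₁ := Fintype.one_lt_card
  rw [card_SL_two, card_SL_two] at h
  have hsq : Fintype.card F₁ ^ 2 < Fintype.card F₂ ^ 2 := Nat.pow_lt_pow_left hlt two_ne_zero
  have hpos : 1 < Fintype.card F₁ ^ 2 := Nat.one_lt_pow two_ne_zero hq
  have := Nat.mul_lt_mul_of_lt_of_le (Nat.sub_lt_sub_right hpos.le hsq) hle (by omega)
  linarith

theorem stmt4 (ℓ : ℕ) (hprime : Nat.Prime ℓ) (hℓ : 5 ≤ ℓ)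
    (F₁ F₂ : Type*) [Field F₁] [Fintype F₁] [CharP F₁ ℓ] [Field F₂] [Fintype F₂] [CharP F₂ ℓ]
    (G : Subgroup (SpecialLinearGroup (Fin 2) F₁ × SpecialLinearGroup (Fin 2) F₂))
    (hproj1 : ∀ a : SpecialLinearGroup (Fin 2) F₁, ∃ b, (a, b) ∈ G)
    (hproj2 : ∀ b : SpecialLinearGroup (Fin 2) F₂, ∃ a, (a, b) ∈ G)
    (hproper : G ≠ ⊤) :
    Fintype.card F₁ = Fintype.card F₂ := by
  have hI₁ : Function.Surjective (Prod.fst ∘ G.subtype) := fun a =>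
    (hproj1 a).elim fun b hb => ⟨⟨(a, b), hb⟩, rfl⟩
  have hI₂ : Function.Surjective (Prod.snd ∘ G.subtype) := fun b =>
    (hproj2 b).elim fun a ha => ⟨⟨(a, b), ha⟩, rfl⟩
  have hN₁ := Subgroup.normal_goursatFst hI₁
  have hN₂ := Subgroup.normal_goursatSnd hI₂
  obtain ⟨e, -⟩ := Subgroup.goursat_surjective hI₁ hI₂
  have hcard := Nat.card_congr e.toEquiv
  have htop : G.goursatFst = ⊤ ↔ G.goursatSnd = ⊤ := by
    rw [← Subgroup.index_eq_one, ← Subgroup.index_eq_one, Subgroup.index, Subgroup.index, hcard]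
  have hfst : G.goursatFst ≠ ⊤ := fun h => hproper <| top_le_iff.1 <| by
    simpa [h, htop.1 h] using Subgroup.goursatFst_prod_goursatSnd_le G
  have hF₁ : 4 ≤ Fintype.card F₁ := by
    have := Nat.le_of_dvd Fintype.card_pos
      ((CharP.cast_eq_zero_iff F₁ ℓ _).1 (FiniteField.cast_card_eq_zero F₁))
    omega
  have hF₂ : 4 ≤ Fintype.card F₂ := by
    have := Nat.le_of_dvd Fintype.card_pos
      ((CharP.cast_eq_zero_iff F₂ ℓ _).1 (FiniteField.cast_card_eq_zero F₂))
    omega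
  have h₁ := card_SL_two_le_two_mul_card_quotient hF₁ _ hfst
  have h₂ := card_SL_two_le_two_mul_card_quotient hF₂ _ (htop.not.1 hfst)
  have h₁' := Nat.le_of_dvd Nat.card_pos (Subgroup.card_quotient_dvd_card G.goursatFst)
  have h₂' := Nat.le_of_dvd Nat.card_pos (Subgroup.card_quotient_dvd_card G.goursatSnd)
  exact le_antisymm (card_le_of_card_SL_two_le ℓ (by omega))
    (card_le_of_card_SL_two_le ℓ (by omega))
end

section
/- Let k > 1 be an integer and let S₁, …, S_k be finite groups each of which has no nontrivial abelian quotient (equivalently, each S_i is perfect, i.e., equal to its own commutator subgroup). Let G be a subgroup of the direct product S₁ × ⋯ × S_k such that for every pair of indices 1 ≤ i < j ≤ k the projection G → S_i × S_j is surjective. Then G = S₁ × ⋯ × S_k. -/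
/-- If a subgroup of a product of perfect groups surjects onto every product of two factors, then
its elements that are trivial on a given finite set of coordinates not containing `i` still
surject onto the `i`-th factor. -/
theorem Subgroup.map_eval_inf_pi_bot_eq_top {ι : Type*} [Nontrivial ι] {S : ι → Type*}
    [∀ i, Group (S i)] (hperf : ∀ i, _root_.commutator (S i) = ⊤) (G : Subgroup (∀ i, S i))
    (hproj : ∀ i j, i ≠ j → ∀ (x : S i) (y : S j), ∃ g ∈ G, g i = x ∧ g j = y)
    (i : ι) (T : Finset ι) (hi : i ∉ T) :
    (G ⊓ Subgroup.pi (T : Set ι) fun _ => ⊥).map (Pi.evalMonoidHom S i) = ⊤ := by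
  classical
  induction T using Finset.induction_on with
  | empty =>
    obtain ⟨j, hj⟩ := exists_ne i
    refine eq_top_iff.2 fun x _ => ?_
    obtain ⟨g, hg, hgi, -⟩ := hproj i j hj.symm x 1
    exact ⟨g, ⟨hg, by simp [Subgroup.mem_pi]⟩, hgi⟩
  | insert j T _ ih =>
    rw [Finset.mem_insert, not_or] at hi
    rw [← top_le_iff, ← hperf i, _root_.commutator_def, Subgroup.commutator_le]
    intro x _ y _
    obtain ⟨g, ⟨hg, hgT⟩, rfl⟩ := (ih hi.2).ge (Subgroup.mem_top x)
    obtain ⟨h, hh, rfl, hhj⟩ := hproj i j hi.1 y 1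
    refine ⟨g * h * g⁻¹ * h⁻¹, ⟨?_, fun l hl => ?_⟩, rfl⟩
    · exact G.mul_mem (G.mul_mem (G.mul_mem hg hh) (G.inv_mem hg)) (G.inv_mem hh)
    · change g l * h l * (g l)⁻¹ * (h l)⁻¹ = 1
      rcases Finset.mem_insert.1 hl with rfl | hl
      · simp [hhj]
      · simp [show g l = 1 from hgT l hl]

theorem Subgroup.eq_top_of_forall_pair_surjective {ι : Type*} [Finite ι] [Nontrivial ι]
    {S : ι → Type*} [∀ i, Group (S i)] (hperf : ∀ i, _root_.commutator (S i) = ⊤)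
    (G : Subgroup (∀ i, S i))
    (hproj : ∀ i j, i ≠ j → ∀ (x : S i) (y : S j), ∃ g ∈ G, g i = x ∧ g j = y) :
    G = ⊤ := by
  classical
  cases nonempty_fintype ι
  rw [← top_le_iff, ← Subgroup.pi_top Set.univ, Subgroup.pi_le_iff]
  rintro i _ ⟨x, -, rfl⟩
  obtain ⟨g, ⟨hg, hg1⟩, rfl⟩ :=
    (G.map_eval_inf_pi_bot_eq_top hperf hproj i (Finset.univ.erase i) (by simp)).ge
      (Subgroup.mem_top x)
  suffices h : MonoidHom.mulSingle S i (g i) = g from h.symm ▸ hg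
  ext l
  by_cases hl : l = i
  · subst hl
    simp
  · have h1 : g l = 1 := hg1 l (by simp [hl])
    simp [hl, h1]

theorem stmt5 (k : ℕ) (hk : 1 < k) (S : Fin k → Type*) [∀ i, Group (S i)]
    [∀ i, Finite (S i)] (hperf : ∀ i, commutator (S i) = ⊤)
    (G : Subgroup (∀ i, S i))
    (hproj : ∀ i j : Fin k, i < j → ∀ (x : S i) (y : S j),
      ∃ g ∈ G, g i = x ∧ g j = y) :
    G = ⊤ := by
  have : Nontrivial (Fin k) := Fin.nontrivial_iff_two_le.2 hk
  refine G.eq_top_of_forall_pair_surjective hperf fun i j hij x y => ?_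
  rcases hij.lt_or_gt with h | h
  · exact hproj i j h x y
  · obtain ⟨g, hg, hy, hx⟩ := hproj j i h y x
    exact ⟨g, hg, hx, hy⟩
end

section
/- Let E be a number field with ring of integers O, and let ℓ ≥ 5 be a prime that is unramified in E. Let λ₁, …, λ_r be distinct maximal ideals of O lying above ℓ, let O_{λ_i} denote the λ_i-adic completion of O, and let F_{λ_i} = O_{λ_i}/𝔪_{λ_i} be the corresponding residue field. If H is a closed subgroup of SL₂(O_{λ₁}) × ⋯ × SL₂(O_{λ_r}) whose image under componentwise reduction modulo the maximal ideals is all of SL₂(F_{λ₁}) × ⋯ × SL₂(F_{λ_r}), then H = SL₂(O_{λ₁}) × ⋯ × SL₂(O_{λ_r}). -/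
open Matrix IsDedekindDomain

/-- The topology on `SL₂(R)` induced from the topology on matrices over `R`. -/
instance specialLinearGroupTopology (n : Type*) [DecidableEq n] [Fintype n]
    (R : Type*) [CommRing R] [TopologicalSpace R] :
    TopologicalSpace (SpecialLinearGroup n R) :=
  TopologicalSpace.induced (fun g => (g : Matrix n n R)) inferInstance

/-- If `X ^ 2 = 0` and `p ≥ 5` is prime, then raising to the `p`-th power sends
`1 + p ^ n (X + p Y)` to an element of the form `1 + p ^ (n + 1) (X + p Y')`. -/
lemma exists_one_add_pow_smul_pow_prime {A : Type*} [Ring A] {p : ℕ} (hp : p.Prime) (h5 : 5 ≤ p)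
    (n : ℕ) {X : A} (hX : X * X = 0) (Y : A) :
    ∃ Y' : A, (1 + p ^ n • (X + p • Y)) ^ p = 1 + p ^ (n + 1) • (X + p • Y') := by
  set W := X + p • Y with hW
  obtain ⟨V, hV⟩ : ∃ V : A, W * W = p • V :=
    ⟨X * Y + Y * X + p • (Y * Y), by
      simp only [hW, add_mul, mul_add, hX, smul_mul_assoc, mul_smul_comm, smul_add, zero_add]
      abel⟩
  obtain ⟨T, hT⟩ : ∃ T : A, W ^ p = p ^ 2 • T := by
    refine ⟨V * V * W ^ (p - 4), ?_⟩
    have h4 : W ^ p = (W * W) * (W * W) * W ^ (p - 4) := by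
      rw [← pow_two W, ← pow_add, ← pow_add]
      congr 1
      lia
    rw [h4, hV]
    simp only [smul_mul_assoc, mul_smul_comm, smul_smul, pow_two]
  obtain ⟨k, hk⟩ : ∃ k, n * p = n + k := ⟨n * p - n, by
    have := Nat.le_mul_of_pos_right n hp.pos
    lia⟩
  obtain ⟨q, hq⟩ : ∃ q : Polynomial ℤ, (1 + Polynomial.X) ^ p =
      1 + (p : Polynomial ℤ) * Polynomial.X + (p : Polynomial ℤ) * Polynomial.X ^ 2 * q + Polynomial.X ^ p := by
    have hsplit : Finset.Ioo 0 p = insert 1 (Finset.Ioo 1 p) := by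
      ext k
      simp only [Finset.mem_Ioo, Finset.mem_insert]
      lia
    refine ⟨∑ k ∈ Finset.Ioo 1 p, Polynomial.X ^ (k - 2) * ((p.choose k / p : ℕ) : Polynomial ℤ), ?_⟩
    rw [add_comm, add_pow_prime_eq' hp, hsplit, Finset.sum_insert (by simp), mul_add,
      mul_assoc _ (_ ^ 2),
      Finset.mul_sum (a := Polynomial.X ^ 2)]
    have : ∀ k ∈ Finset.Ioo 1 p, (Polynomial.X ^ 2 *
        (Polynomial.X ^ (k - 2) * ((p.choose k / p : ℕ) : Polynomial ℤ)) : Polynomial ℤ) =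
        Polynomial.X ^ k * 1 ^ (p - k) * ((p.choose k / p : ℕ) : Polynomial ℤ) := by
      intro k hk
      rw [Finset.mem_Ioo] at hk
      rw [← mul_assoc, ← pow_add, one_pow, mul_one]
      congr 2
      lia
    rw [Finset.sum_congr rfl this]
    simp [Nat.div_self hp.pos]
    ring
  have hu := congrArg (Polynomial.aeval (p ^ n • W)) hq
  simp only [map_pow, map_add, map_one, map_mul, map_natCast, Polynomial.aeval_X] at hu
  set Q := Polynomial.aeval (p ^ n • W) q
  refine ⟨Y + p ^ n • (V * Q) + p ^ k • T, ?_⟩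
  rw [hu, smul_pow _ _ p, hT, ← pow_mul, hk, pow_two (p ^ n • W)]
  simp only [smul_mul_assoc, mul_smul_comm, hV, ← nsmul_eq_mul]
  rw [hW]
  module

lemma exists_mem_eq_one_add_smul_add {G A : Type*} [Group G] [Ring A] (f : G →* A) (H : Subgroup G)
    {p n : ℕ} (hn : 1 ≤ n) {X₁ X₂ : A}
    (h₁ : ∃ h ∈ H, ∃ Y, f h = 1 + p ^ n • (X₁ + p • Y))
    (h₂ : ∃ h ∈ H, ∃ Y, f h = 1 + p ^ n • (X₂ + p • Y)) :
    ∃ h ∈ H, ∃ Y, f h = 1 + p ^ n • (X₁ + X₂ + p • Y) := by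
  obtain ⟨a, ha, Y, hY⟩ := h₁
  obtain ⟨b, hb, Z, hZ⟩ := h₂
  obtain ⟨m, rfl⟩ := Nat.exists_eq_add_of_le' hn
  refine ⟨a * b, H.mul_mem ha hb, Y + Z + p ^ m • ((X₁ + p • Y) * (X₂ + p • Z)), ?_⟩
  rw [map_mul, hY, hZ]
  simp only [add_mul, mul_add, one_mul, mul_one, smul_add, smul_mul_assoc, mul_smul_comm]
  module

lemma exists_mem_eq_one_add_pow_smul {G A : Type*} [Group G] [Ring A] (f : G →* A) (H : Subgroup G)
    {p : ℕ} (hp : p.Prime) (h5 : 5 ≤ p) {X : A} (hX : X * X = 0)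
    (h : ∃ h ∈ H, ∃ Y, f h = 1 + X + p • Y) (n : ℕ) :
    ∃ h ∈ H, ∃ Y, f h = 1 + p ^ n • (X + p • Y) := by
  induction n with
  | zero => simpa [add_assoc] using h
  | succ n ih =>
    obtain ⟨a, ha, Y, hY⟩ := ih
    obtain ⟨Y', hY'⟩ := exists_one_add_pow_smul_pow_prime hp h5 n hX Y
    exact ⟨a ^ p, H.pow_mem ha p, Y', by rw [map_pow, hY, hY']⟩

/-- The inclusion of a product of special linear groups into the product of the matrix rings. -/
def piSpecialLinearGroupToMatrix {ι : Type*} (n : Type*) [DecidableEq n] [Fintype n]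
    (R : ι → Type*) [∀ i, CommRing (R i)] :
    (∀ i, SpecialLinearGroup n (R i)) →* (∀ i, Matrix n n (R i)) where
  toFun g i := g i
  map_one' := rfl
  map_mul' _ _ := rfl

lemma exists_mem_of_trace_eq_zero {ι : Type*} {R : ι → Type*} [∀ i, CommRing (R i)]
    {p : ℕ} (hp : p.Prime) (h5 : 5 ≤ p) (H : Subgroup (∀ i, SpecialLinearGroup (Fin 2) (R i)))
    (hH : ∀ g, ∃ h ∈ H, ∃ Y, piSpecialLinearGroupToMatrix (Fin 2) R h =
      piSpecialLinearGroupToMatrix (Fin 2) R g + p • Y) {n : ℕ} (hn : 1 ≤ n)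
    (a b c : ∀ i, R i) :
    ∃ h ∈ H, ∃ Y, piSpecialLinearGroupToMatrix (Fin 2) R h =
      1 + p ^ n • ((fun i => !![a i, b i; c i, -a i]) + p • Y) := by
  have key (X : ∀ i, Matrix (Fin 2) (Fin 2) (R i)) (hX : X * X = 0)
      (hdet : ∀ i, (1 + X i).det = 1) :
      ∃ h ∈ H, ∃ Y, piSpecialLinearGroupToMatrix (Fin 2) R h = 1 + p ^ n • (X + p • Y) :=
    exists_mem_eq_one_add_pow_smul _ H hp h5 hX (hH fun i => ⟨1 + X i, hdet i⟩) n
  have h₁ := key (fun i => !![a i, -a i; a i, -a i])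
    (by funext i; ext j k; fin_cases j <;> fin_cases k <;> simp [Matrix.mul_apply])
    (by intro i; simp [Matrix.det_fin_two]; ring)
  have h₂ := key (fun i => !![0, b i + a i; 0, 0])
    (by funext i; ext j k; fin_cases j <;> fin_cases k <;> simp [Matrix.mul_apply])
    (by intro i; simp [Matrix.det_fin_two])
  have h₃ := key (fun i => !![0, 0; c i - a i, 0])
    (by funext i; ext j k; fin_cases j <;> fin_cases k <;> simp [Matrix.mul_apply])
    (by intro i; simp [Matrix.det_fin_two])
  convert exists_mem_eq_one_add_smul_add _ H hn (exists_mem_eq_one_add_smul_add _ H hn h₁ h₂) h₃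
    using 8
  funext i
  ext j k
  fin_cases j <;> fin_cases k <;> simp

/-- A subgroup of a product of groups `SL₂(R i)` that contains every element modulo a prime
`p ≥ 5` contains every element modulo every power of `p`. -/
theorem exists_mem_eq_add_pow_smul {ι : Type*} {R : ι → Type*} [∀ i, CommRing (R i)]
    [∀ i, IsDomain (R i)] [∀ i, CharZero (R i)]
    {p : ℕ} (hp : p.Prime) (h5 : 5 ≤ p) (H : Subgroup (∀ i, SpecialLinearGroup (Fin 2) (R i)))
    (hH : ∀ g, ∃ h ∈ H, ∃ Y, piSpecialLinearGroupToMatrix (Fin 2) R h =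
      piSpecialLinearGroupToMatrix (Fin 2) R g + p • Y) (n : ℕ)
    (g : ∀ i, SpecialLinearGroup (Fin 2) (R i)) :
    ∃ h ∈ H, ∃ Y, piSpecialLinearGroupToMatrix (Fin 2) R h =
      piSpecialLinearGroupToMatrix (Fin 2) R g + p ^ (n + 1) • Y := by
  induction n with
  | zero => simpa using hH g
  | succ n ih =>
    set f := piSpecialLinearGroupToMatrix (Fin 2) R
    obtain ⟨h, hh, Y, hY⟩ := ih
    have hk : f (h⁻¹ * g) = 1 + p ^ (n + 1) • (-(f h⁻¹ * Y)) := by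
      have : f g = f h - p ^ (n + 1) • Y := by rw [hY]; abel
      rw [map_mul, this, mul_sub, ← map_mul, inv_mul_cancel, map_one, mul_smul_comm, smul_neg,
        sub_eq_add_neg]
    set Z := -(f h⁻¹ * Y)
    have htr (i : ι) : Z i 0 0 + Z i 1 1 + p ^ (n + 1) * (Z i).det = 0 := by
      have hd : ((f (h⁻¹ * g)) i).det = 1 := ((h⁻¹ * g) i).2
      rw [hk] at hd
      have hp0 : (p : R i) ^ (n + 1) ≠ 0 := pow_ne_zero _ (Nat.cast_ne_zero.2 hp.ne_zero)
      apply mul_left_cancel₀ hp0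
      rw [Matrix.det_fin_two] at hd ⊢
      have hentry (j k : Fin 2) : (1 + p ^ (n + 1) • Z) i j k =
          (1 : Matrix (Fin 2) (Fin 2) (R i)) j k + (p : R i) ^ (n + 1) * Z i j k := by
        rw [← Nat.cast_pow, ← nsmul_eq_mul]
        rfl
      simp only [hentry, Matrix.one_apply_eq, Matrix.one_apply_ne zero_ne_one,
        Matrix.one_apply_ne one_ne_zero] at hd
      linear_combination hd
    obtain ⟨h', hh', Y', hY'⟩ := exists_mem_of_trace_eq_zero hp h5 H hH (n := n + 1) (by lia)
      (fun i => Z i 0 0) (fun i => Z i 0 1) (fun i => Z i 1 0)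
    have hZ' : (fun i => !![Z i 0 0, Z i 0 1; Z i 1 0, -Z i 0 0]) =
        Z + p • fun i => !![0, 0; 0, p ^ n * (Z i).det] := by
      funext i
      ext j k
      rw [Pi.add_apply, Pi.smul_apply, Matrix.add_apply, Matrix.smul_apply, nsmul_eq_mul]
      fin_cases j <;> fin_cases k <;> simp
      linear_combination -htr i
    refine ⟨h * h', H.mul_mem hh hh',
      f h * ((fun i => !![0, 0; 0, p ^ n * (Z i).det]) + Y'), ?_⟩
    have hg : f g = f h * f (h⁻¹ * g) := by rw [← map_mul, mul_inv_cancel_left]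
    rw [hg, map_mul, hY', hk, hZ', ← mul_smul_comm, ← mul_add]
    congr 1
    rw [pow_succ p (n + 1), mul_smul]
    simp only [smul_add]
    abel

section AdicCompletion

variable {R : Type*} [CommRing R] [IsDedekindDomain R] {K : Type*} [Field K] [Algebra R K]
  [IsFractionRing R K] (v : HeightOneSpectrum R)

open WithZero

lemma valued_natCast_adicCompletion_eq_exp {p : ℕ} (hp : (p : R) ∈ v.asIdeal)
    (hsq : Squarefree (Ideal.span {(p : R)})) :
    Valued.v (p : v.adicCompletion K) = exp (-1 : ℤ) := by
  have hv : Valued.v (p : v.adicCompletion K) = v.intValuation (p : R) := by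
    rw [← v.valuation_of_algebraMap (K := K), ← v.valuedAdicCompletion_eq_valuation (K := K)]
    simp
  rw [hv]
  have h1 : v.intValuation (p : R) ≤ exp (-(1 : ℕ) : ℤ) := by
    rw [v.intValuation_le_pow_iff_mem]
    simpa using hp
  have h2 : ¬ v.intValuation (p : R) ≤ exp (-(2 : ℕ) : ℤ) := by
    rw [v.intValuation_le_pow_iff_dvd, pow_two]
    intro h
    exact v.isPrime.ne_top (Ideal.isUnit_iff.1 (hsq _ h))
  have h0 : v.intValuation (p : R) ≠ 0 := fun h => h2 (by rw [h]; exact zero_le)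
  obtain ⟨m, hm⟩ : ∃ m : ℤ, v.intValuation (p : R) = exp m := ⟨_, (exp_log h0).symm⟩
  rw [hm] at h1 h2 ⊢
  rw [exp_le_exp] at h1 h2
  congr 1
  push_cast at h1 h2
  lia

lemma natCast_dvd_of_residue_eq_zero {p : ℕ} (hp : (p : R) ∈ v.asIdeal)
    (hsq : Squarefree (Ideal.span {(p : R)})) {x : v.adicCompletionIntegers K}
    (hx : IsLocalRing.residue _ x = 0) : (p : v.adicCompletionIntegers K) ∣ x := by
  have hv := valued_natCast_adicCompletion_eq_exp (K := K) v hp hsq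
  rw [IsLocalRing.residue_eq_zero_iff, IsLocalRing.mem_maximalIdeal, mem_nonunits_iff,
    HeightOneSpectrum.adicCompletionIntegers.isUnit_iff_valued_eq_one] at hx
  have hlt : Valued.v (x : v.adicCompletion K) < 1 := lt_of_le_of_ne x.2 hx
  have hle : Valued.v (x : v.adicCompletion K) ≤ exp (-1 : ℤ) := by
    by_cases h0 : Valued.v (x : v.adicCompletion K) = 0
    · rw [h0]; exact zero_le
    · rw [← exp_log h0] at hlt ⊢
      rw [← exp_zero, exp_lt_exp] at hlt
      rw [exp_le_exp]
      lia
  apply (HeightOneSpectrum.adicCompletionIntegers.integers K v).dvd_of_le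
  rw [← hv] at hle
  simpa using hle

lemma tendsto_pow_mul_adicCompletionIntegers {p : ℕ} (hp : (p : R) ∈ v.asIdeal)
    (hsq : Squarefree (Ideal.span {(p : R)})) (y : ℕ → v.adicCompletionIntegers K) :
    Filter.Tendsto (fun n => (p : v.adicCompletionIntegers K) ^ (n + 1) * y n) Filter.atTop
      (nhds 0) := by
  rw [tendsto_subtype_rng]
  have hv := valued_natCast_adicCompletion_eq_exp (K := K) v hp hsq
  have ht : Filter.Tendsto (fun n : ℕ => (p : v.adicCompletion K) ^ (n + 1)) Filter.atTop
      (nhds 0) := by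
    refine (Filter.tendsto_add_atTop_iff_nat 1).2
      (Valued.tendsto_zero_pow_of_v_lt_one ?_)
    rw [hv, ← exp_zero, exp_lt_exp]
    lia
  have hb := Valued.hasBasis_nhds_zero (v.adicCompletion K) (WithZero (Multiplicative ℤ))
  refine hb.tendsto_right_iff.2 fun γ hγ => ?_
  filter_upwards [hb.tendsto_right_iff.1 ht γ hγ] with n hn
  refine lt_of_le_of_lt ?_ hn
  rw [Valuation.restrict_le_iff]
  simpa using mul_le_of_le_one_right' (y n).2

end AdicCompletion

theorem stmt6 (E : Type*) [Field E] [NumberField E] (ℓ : ℕ) (hprime : Nat.Prime ℓ) (hℓ : 5 ≤ ℓ)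
    (hunram : Squarefree (Ideal.span {(ℓ : NumberField.RingOfIntegers E)}))
    (r : ℕ) (hr : 1 ≤ r)
    (v : Fin r → HeightOneSpectrum (NumberField.RingOfIntegers E))
    (hdistinct : Function.Injective v)
    (habove : ∀ i, (ℓ : NumberField.RingOfIntegers E) ∈ (v i).asIdeal)
    (H : Subgroup (∀ i, SpecialLinearGroup (Fin 2) ((v i).adicCompletionIntegers E)))
    (hclosed : IsClosed (H : Set (∀ i, SpecialLinearGroup (Fin 2) ((v i).adicCompletionIntegers E))))
    (hsurj : ∀ g : (∀ i, SpecialLinearGroup (Fin 2)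
        (IsLocalRing.ResidueField ((v i).adicCompletionIntegers E))),
      ∃ h ∈ H, ∀ i, SpecialLinearGroup.map
        (IsLocalRing.residue ((v i).adicCompletionIntegers E)) (h i) = g i) :
    H = ⊤ := by
  have hH : ∀ g, ∃ h ∈ H, ∃ Y,
      piSpecialLinearGroupToMatrix (Fin 2) (fun i => (v i).adicCompletionIntegers E) h =
      piSpecialLinearGroupToMatrix (Fin 2) (fun i => (v i).adicCompletionIntegers E) g
        + ℓ • Y := by
    intro g
    obtain ⟨h, hh, hg⟩ := hsurj fun i => SpecialLinearGroup.map (IsLocalRing.residue _) (g i)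
    have hdvd (i : Fin r) (j k : Fin 2) :
        (ℓ : (v i).adicCompletionIntegers E) ∣ h i j k - g i j k := by
      refine natCast_dvd_of_residue_eq_zero (v i) (habove i) hunram ?_
      have := congrArg (fun M => M.1 j k) (hg i)
      rw [map_sub, sub_eq_zero]
      exact this
    choose Y hY using hdvd
    refine ⟨h, hh, fun i => Matrix.of (Y i), ?_⟩
    funext i
    ext1 j k
    have := hY i j k
    change h i j k = g i j k + ℓ • Y i j k
    rw [nsmul_eq_mul, ← this, add_sub_cancel]
  have : ∀ i, CharZero ((v i).adicCompletionIntegers E) := fun i =>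
    charZero_of_injective_algebraMap
      (FaithfulSMul.algebraMap_injective (NumberField.RingOfIntegers E) _)
  rw [eq_top_iff]
  intro g _
  choose h hh Y hY using fun n => exists_mem_eq_add_pow_smul hprime hℓ H hH n g
  refine hclosed.mem_of_tendsto (f := h) (b := Filter.atTop) ?_ (Filter.Eventually.of_forall hh)
  rw [tendsto_pi_nhds]
  intro i
  rw [nhds_induced, Filter.tendsto_comap_iff]
  refine tendsto_pi_nhds.2 fun j => tendsto_pi_nhds.2 fun k => ?_
  have hE (n : ℕ) : h n i j k = g i j k + (ℓ : (v i).adicCompletionIntegers E) ^ (n + 1) *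
      Y n i j k := by
    have := congrFun (congrFun (congrFun (hY n) i) j) k
    change h n i j k = g i j k + ℓ ^ (n + 1) • Y n i j k at this
    rwa [nsmul_eq_mul, Nat.cast_pow] at this
  have ht := (tendsto_pow_mul_adicCompletionIntegers (v i) (habove i) hunram
    fun n => Y n i j k).const_add (g i j k)
  rw [add_zero] at ht
  exact ht.congr fun n => (hE n).symm
end
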